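/- arXiv:1606.07824 — 2 statements merged into one kernel-verified Lean document; each statement's English description precedes it below -/
import Mathlib

section
/- Let Q_M be a quasianalytic Denjoy–Carleman class, U ⊆ ℝ^n open, and X a closed Q_M-subset of U. Then the set of Q_M-smooth points of X is dense in X. -/
namespace QDC

/-- `M` is a sequence defining a quasianalytic Denjoy–Carleman class: positive,
logarithmically convex, with `sup_k (M_{k+1}/M_k)^{1/k} < ∞` and
`Σ_k M_k/((k+1) M_{k+1}) = ∞`. -/
def IsDCSeq (M : ℕ → ℝ) : Prop :=
  (∀ k, 0 < M k) ∧
  (∀ k, M (k + 1) / M k ≤ M (k + 2) / M (k + 1)) ∧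
  (∃ C : ℝ, ∀ k : ℕ, 1 ≤ k → (M (k + 1) / M k) ^ ((1 : ℝ) / k) ≤ C) ∧
  ¬ Summable (fun k => M k / ((k + 1) * M (k + 1)))

variable {σ : Type*} [Fintype σ] [DecidableEq σ]

/-- First-order partial derivative in the `i`-th coordinate direction. -/
noncomputable def pd (i : σ) (f : (σ → ℝ) → ℝ) : (σ → ℝ) → ℝ :=
  fun x => fderiv ℝ f x (Pi.single i 1)

/-- Iterated partial derivative `∂^{|α|} f / ∂x^α` for a multi-index `α`. -/
noncomputable def mpd (α : σ → ℕ) (f : (σ → ℝ) → ℝ) : (σ → ℝ) → ℝ :=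
  (Finset.univ : Finset σ).toList.foldr (fun i g => (pd i)^[α i] g) f

/-- `α! = α_1! ⋯ α_n!`. -/
def mfact (α : σ → ℕ) : ℕ := ∏ i, (α i).factorial

/-- `|α| = α_1 + ⋯ + α_n`. -/
def mdeg (α : σ → ℕ) : ℕ := ∑ i, α i

/-- `f` belongs to the Denjoy–Carleman class `Q_M(V)`. -/
def MemDC (M : ℕ → ℝ) (V : Set (σ → ℝ)) (f : (σ → ℝ) → ℝ) : Prop :=
  ContDiffOn ℝ (⊤ : ℕ∞) f V ∧
  ∀ K ⊆ V, IsCompact K → ∃ A B : ℝ, 0 < A ∧ 0 < B ∧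
    ∀ x ∈ K, ∀ α : σ → ℕ,
      |mpd α f x| ≤ A * B ^ mdeg α * (mfact α : ℝ) * M (mdeg α)

/-- `X` is a closed `Q_M`-subset of the open set `U`: it is closed in `U` and locally
the common zero set of finitely many functions of class `Q_M`. -/
def IsQMClosed (M : ℕ → ℝ) {n : ℕ} (U X : Set (Fin n → ℝ)) : Prop :=
  X ⊆ U ∧ closure X ∩ U ⊆ X ∧
  ∀ b ∈ X, ∃ V : Set (Fin n → ℝ), IsOpen V ∧ b ∈ V ∧ V ⊆ U ∧
    ∃ (k : ℕ) (g : Fin k → ((Fin n → ℝ) → ℝ)),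
      (∀ i, MemDC M V (g i)) ∧ X ∩ V = {x ∈ V | ∀ i, g i x = 0}

/-- `f : X∖Z → ℝ` belongs to `Q_M(X,Z)`: it is a quotient `g/h` of restrictions to `X` of
functions of class `Q_M` on a neighbourhood of `X`, where `h` vanishes nowhere on `X∖Z`. -/
def MemQXZ (M : ℕ → ℝ) {n : ℕ} (X Z : Set (Fin n → ℝ)) (f : (Fin n → ℝ) → ℝ) : Prop :=
  ∃ (V : Set (Fin n → ℝ)) (g h : (Fin n → ℝ) → ℝ), IsOpen V ∧ X ⊆ V ∧
    MemDC M V g ∧ MemDC M V h ∧ (∀ x ∈ X \ Z, h x ≠ 0) ∧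
    ∀ x ∈ X \ Z, f x = g x / h x

/-- `b` is a `Q_M`-smooth point of `X ⊆ ℝ^n`: near `b`, `X` is the graph of a
`Q_M`-map over some subset `I` of the coordinates. -/
def QMSmoothPt (M : ℕ → ℝ) {n : ℕ} (X : Set (Fin n → ℝ)) (b : Fin n → ℝ) : Prop :=
  ∃ W : Set (Fin n → ℝ), IsOpen W ∧ b ∈ W ∧
    ∃ (I : Finset (Fin n)) (Ω : Set ({ i : Fin n // i ∈ I } → ℝ))
      (ψ : ({ i : Fin n // i ∈ I } → ℝ) → ({ i : Fin n // i ∉ I } → ℝ)),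
      IsOpen Ω ∧ (∀ j : { i : Fin n // i ∉ I }, MemDC M Ω (fun u => ψ u j)) ∧
      X ∩ W = {y ∈ W | (fun i : { i : Fin n // i ∈ I } => y i) ∈ Ω ∧
        ∀ j : { i : Fin n // i ∉ I }, y j = ψ (fun i : { i : Fin n // i ∈ I } => y i) j}

/-- The formal Taylor expansion `T_a f` of `f` at `a`, as a multivariate formal
power series. -/
noncomputable def taylorAt {n : ℕ} (f : (Fin n → ℝ) → ℝ) (a : Fin n → ℝ) :
    MvPowerSeries (Fin n) ℝ :=
  fun α : Fin n →₀ ℕ => mpd (fun i => α i) f a / (mfact fun i => α i : ℕ)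

/-- `f` is flat at `x`: all iterated partial derivatives (including order `0`) vanish. -/
def FlatAt {n : ℕ} (f : (Fin n → ℝ) → ℝ) (x : Fin n → ℝ) : Prop :=
  ∀ α : Fin n → ℕ, mpd α f x = 0

end QDC

namespace QDC
open Filter Topology Finset

theorem IsDCSeq.pos {M : ℕ → ℝ} (hM : IsDCSeq M) (k : ℕ) : 0 < M k := hM.1 k

theorem IsDCSeq.ratio_mono {M : ℕ → ℝ} (hM : IsDCSeq M) : Monotone (fun k => M (k + 1) / M k) :=
  monotone_nat_of_le_succ hM.2.1

/-- The double factorial weight. -/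
def dw : ℕ → ℝ
  | 0 => 1
  | 1 => 1
  | (j + 2) => (2 * j + 1) * dw (j + 1)

theorem dw_pos (j : ℕ) : 0 < dw j := by
  induction j using dw.induct with
  | case1 => simp [dw]
  | case2 => simp [dw]
  | case3 j ih => simp only [dw]; positivity

theorem dw_succ_le (n : ℕ) : dw (n + 1) ≤ 2 ^ n * n.factorial := by
  induction n with
  | zero => simp [dw]
  | succ n ih =>
    simp only [dw, Nat.factorial_succ, pow_succ]
    push_cast
    have : (0:ℝ) ≤ 2 ^ n * n.factorial := by positivity
    nlinarith [Nat.cast_nonneg (α := ℝ) n]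

theorem fact_le_dw (n : ℕ) : ((n + 1).factorial : ℝ) ≤ 2 ^ n * dw (n + 1) := by
  induction n with
  | zero => simp [dw]
  | succ n ih =>
    rw [Nat.factorial_succ, pow_succ]
    simp only [dw]
    push_cast
    have h : (0:ℝ) ≤ 2 ^ n * dw (n+1) := by have := dw_pos (n+1); positivity
    have h0 := Nat.cast_nonneg (α := ℝ) n
    calc ((n:ℝ) + 1 + 1) * ((n+1).factorial : ℝ) ≤ (n + 1 + 1) * (2 ^ n * dw (n+1)) := by gcongr
      _ ≤ (2 * (2 * n + 1)) * (2 ^ n * dw (n+1)) := by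
        gcongr ?_ * _
        rcases n with _ | n
        · norm_num
        · push_cast at *; linarith
      _ = _ := by ring

/-- weight of an ordered finpartition -/
noncomputable def wt (M : ℕ → ℝ) {n : ℕ} (c : OrderedFinpartition n) : ℝ :=
  (c.length.factorial : ℝ) * M c.length * (M 1)⁻¹ ^ c.length *
    ∏ i, (dw (c.partSize i) * M (c.partSize i))

theorem wt_nonneg {M : ℕ → ℝ} (hM : IsDCSeq M) {n : ℕ} (c : OrderedFinpartition n) :
    0 ≤ wt M c := by
  unfold wt
  have h := fun k => (hM.pos k).le
  have h1 := h 1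
  have h2 := h c.length
  have : 0 ≤ ∏ i, (dw (c.partSize i) * M (c.partSize i)) :=
    Finset.prod_nonneg fun i _ => mul_nonneg (dw_pos _).le (h _)
  positivity

theorem wt_extendLeft {M : ℕ → ℝ} (hM : IsDCSeq M) {n : ℕ} (c : OrderedFinpartition n) :
    wt M c.extendLeft ≤ wt M c * ((c.length + 1) * (M (n + 1) / M n)) := by
  have h1 := (hM.pos 1).ne'
  have hr : M (c.length + 1) / M c.length ≤ M (n + 1) / M n := hM.ratio_mono c.length_le
  have hL := (hM.pos c.length).ne'
  have key : wt M c.extendLeft = wt M c * ((c.length + 1) * (M (c.length + 1) / M c.length)) := by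
    unfold wt
    have : ∏ i, (dw (c.extendLeft.partSize i) * M (c.extendLeft.partSize i)) =
      M 1 * ∏ i, (dw (c.partSize i) * M (c.partSize i)) := by
      change ∏ i : Fin (c.length + 1), (dw ((Fin.cons 1 c.partSize : Fin (c.length+1) → ℕ) i)
        * M ((Fin.cons 1 c.partSize : Fin (c.length+1) → ℕ) i)) = _
      rw [Fin.prod_univ_succ]
      simp [dw]
    rw [this]
    change ((c.length+1).factorial : ℝ) * M (c.length+1) * (M 1)⁻¹ ^ (c.length+1) * _ = _
    rw [Nat.factorial_succ, pow_succ]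
    push_cast
    field_simp
  rw [key]
  gcongr
  exact wt_nonneg hM c

theorem wt_extendMiddle {M : ℕ → ℝ} (hM : IsDCSeq M) {n : ℕ} (c : OrderedFinpartition n)
    (k : Fin c.length) :
    wt M (c.extendMiddle k) ≤ wt M c * ((2 * c.partSize k - 1) * (M (n + 1) / M n)) := by
  have hr : M (c.partSize k + 1) / M (c.partSize k) ≤ M (n + 1) / M n :=
    hM.ratio_mono (c.partSize_le k)
  have hL := (hM.pos (c.partSize k)).ne'
  have hp := c.partSize_pos k
  have key : wt M (c.extendMiddle k) =
      wt M c * ((2 * c.partSize k - 1) * (M (c.partSize k + 1) / M (c.partSize k))) := by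
    unfold wt
    have : ∏ i, (dw ((c.extendMiddle k).partSize i) * M ((c.extendMiddle k).partSize i)) =
      ((2 * c.partSize k - 1) * (M (c.partSize k + 1) / M (c.partSize k))) *
        ∏ i, (dw (c.partSize i) * M (c.partSize i)) := by
      change ∏ i : Fin (c.length), (dw ((Function.update c.partSize k (c.partSize k + 1)) i)
        * M ((Function.update c.partSize k (c.partSize k + 1)) i)) = _
      rw [← Finset.mul_prod_erase _ _ (Finset.mem_univ k),
        ← Finset.mul_prod_erase _ (fun i => dw (c.partSize i) * M (c.partSize i))
          (Finset.mem_univ k), ← mul_assoc]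
      congr 1
      · simp only [Function.update_self]
        obtain ⟨j, hj⟩ : ∃ j, c.partSize k = j + 1 := ⟨c.partSize k - 1, by omega⟩
        rw [hj] at hL ⊢
        simp only [dw]
        push_cast
        field_simp
        ring
      · refine Finset.prod_congr rfl fun i hi => ?_
        rw [Function.update_of_ne (Finset.ne_of_mem_erase hi)]
    rw [this]
    change ((c.length).factorial : ℝ) * M (c.length) * (M 1)⁻¹ ^ (c.length) * _ = _
    ring
  rw [key]
  have : (0:ℝ) ≤ 2 * c.partSize k - 1 := by
    have : (1:ℝ) ≤ c.partSize k := by exact_mod_cast hp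
    linarith
  gcongr
  exact wt_nonneg hM c

theorem sum_partSize {n : ℕ} (c : OrderedFinpartition n) : ∑ i, c.partSize i = n := by
  have := Fintype.card_congr c.equivSigma
  simpa using this

theorem sum_wt_le {M : ℕ → ℝ} (hM : IsDCSeq M) (n : ℕ) :
    ∑ c : OrderedFinpartition n, wt M c ≤ dw (n + 1) * M n := by
  induction n with
  | zero =>
    rw [Fintype.sum_unique]
    have h : wt M (default : OrderedFinpartition 0) = M 0 := by
      unfold wt
      change ((0).factorial : ℝ) * M 0 * (M 1)⁻¹ ^ 0 * ∏ i : Fin 0, _ = _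
      simp
    rw [h]
    simp [dw]
  | succ n ih =>
    rw [← (OrderedFinpartition.extendEquiv n).sum_comp, Fintype.sum_sigma]
    have hr : 0 < M (n + 1) / M n := div_pos (hM.pos _) (hM.pos _)
    calc ∑ c : OrderedFinpartition n, ∑ o : Option (Fin c.length),
          wt M (OrderedFinpartition.extendEquiv n ⟨c, o⟩)
        ≤ ∑ c : OrderedFinpartition n, wt M c * ((2 * n + 1) * (M (n + 1) / M n)) := by
          refine Finset.sum_le_sum fun c _ => ?_
          rw [Fintype.sum_option]
          have h1 := wt_extendLeft hM c
          have h2 := Finset.sum_le_sum (s := Finset.univ) fun k _ => wt_extendMiddle hM c k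
          have h3 : ∑ k, wt M c * ((2 * (c.partSize k : ℝ) - 1) * (M (n + 1) / M n)) =
            wt M c * ((2 * n - c.length) * (M (n + 1) / M n)) := by
            rw [← Finset.mul_sum, ← Finset.sum_mul, Finset.sum_sub_distrib, ← Finset.mul_sum,
              ← Nat.cast_sum, sum_partSize]
            simp
          rw [h3] at h2
          calc _ ≤ _ := add_le_add h1 h2
            _ = _ := by ring
      _ = (∑ c : OrderedFinpartition n, wt M c) * ((2 * n + 1) * (M (n + 1) / M n)) := by
        rw [Finset.sum_mul]
      _ ≤ (dw (n + 1) * M n) * ((2 * n + 1) * (M (n + 1) / M n)) := by gcongr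
      _ = _ := by
        have := (hM.pos n).ne'
        simp only [dw]
        field_simp

variable {E F G : Type*} [NormedAddCommGroup E] [NormedSpace ℝ E] [NormedAddCommGroup F]
  [NormedSpace ℝ F] [NormedAddCommGroup G] [NormedSpace ℝ G]

theorem norm_comp_le {f : F → G} {g : E → F} {s : Set E} {t : Set F} (ht : IsOpen t)
    (hf : ContDiffOn ℝ (⊤ : ℕ∞) f t) (hs : IsOpen s) (hg : ContDiffOn ℝ (⊤ : ℕ∞) g s)
    (h : Set.MapsTo g s t) {x : E} (hx : x ∈ s) (n : ℕ) :
    ‖iteratedFDeriv ℝ n (f ∘ g) x‖ ≤ ∑ c : OrderedFinpartition n,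
      ‖iteratedFDeriv ℝ c.length f (g x)‖ * ∏ i, ‖iteratedFDeriv ℝ (c.partSize i) g x‖ := by
  have h1 := (hf.ftaylorSeriesWithin ht.uniqueDiffOn).comp
    (hg.ftaylorSeriesWithin hs.uniqueDiffOn) h
  have h2 := h1.eq_iteratedFDerivWithin_of_uniqueDiffOn (m := n)
    (by exact_mod_cast le_top) hs.uniqueDiffOn hx
  rw [← iteratedFDerivWithin_of_isOpen n hs hx, ← h2]
  unfold FormalMultilinearSeries.taylorComp
  refine (norm_sum_le _ _).trans (Finset.sum_le_sum fun c _ => ?_)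
  refine (OrderedFinpartition.norm_compAlongOrderedFinpartition_le _ _ _).trans (le_of_eq ?_)
  simp only [ftaylorSeriesWithin]
  rw [iteratedFDerivWithin_of_isOpen _ ht (h hx)]
  congr 1
  refine Finset.prod_congr rfl fun i _ => ?_
  rw [iteratedFDerivWithin_of_isOpen _ hs hx]

end QDC

namespace QDC
open Filter Topology Finset

variable {E F G : Type*} [NormedAddCommGroup E] [NormedSpace ℝ E] [NormedAddCommGroup F]
  [NormedSpace ℝ F] [NormedAddCommGroup G] [NormedSpace ℝ G]

/-- Local (germ) version of the Denjoy–Carleman condition for maps of normed spaces. -/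
def DCAt (M : ℕ → ℝ) (f : E → F) (x : E) : Prop :=
  ∃ A B : ℝ, 0 < A ∧ 0 < B ∧ ∀ᶠ y in 𝓝 x, ContDiffAt ℝ (⊤ : ℕ∞) f y ∧
    ∀ k : ℕ, ‖iteratedFDeriv ℝ k f y‖ ≤ A * B ^ k * k.factorial * M k

variable {M : ℕ → ℝ}

theorem DCAt.eventually {f : E → F} {x : E} (h : DCAt M f x) : ∀ᶠ y in 𝓝 x, DCAt M f y := by
  obtain ⟨A, B, hA, hB, h⟩ := h
  exact h.eventually_nhds.mono fun y hy => ⟨A, B, hA, hB, hy⟩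

theorem DCAt.contDiffAt {f : E → F} {x : E} (h : DCAt M f x) : ContDiffAt ℝ (⊤ : ℕ∞) f x := by
  obtain ⟨A, B, hA, hB, h⟩ := h
  exact h.self_of_nhds.1

theorem DCAt.continuousAt {f : E → F} {x : E} (h : DCAt M f x) : ContinuousAt f x :=
  h.contDiffAt.continuousAt

theorem DCAt.congr {f g : E → F} {x : E} (h : DCAt M f x) (hfg : g =ᶠ[𝓝 x] f) : DCAt M g x := by
  obtain ⟨A, B, hA, hB, h⟩ := h
  refine ⟨A, B, hA, hB, ?_⟩
  filter_upwards [h, hfg.eventuallyEq_nhds] with y hy hy2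
  refine ⟨hy.1.congr_of_eventuallyEq hy2, fun k => ?_⟩
  rw [(hy2.iteratedFDeriv ℝ k).eq_of_nhds]
  exact hy.2 k

theorem DCAt.comp (hM : IsDCSeq M) {f : F → G} {g : E → F} {x : E} (hf : DCAt M f (g x))
    (hg : DCAt M g x) : DCAt M (f ∘ g) x := by
  have hgc := hg.continuousAt
  obtain ⟨A, B, hA, hB, hf⟩ := hf
  obtain ⟨A', B', hA', hB', hg⟩ := hg
  obtain ⟨t, ht, hto, hxt⟩ := eventually_nhds_iff.1 hf
  obtain ⟨s, hs, hso, hxs⟩ := eventually_nhds_iff.1 (hg.and (hgc.eventually (hto.mem_nhds hxt)))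
  set C : ℝ := max 1 (B * A' * M 1) with hC
  have hC1 : 1 ≤ C := le_max_left _ _
  have hM1 := hM.pos 1
  refine ⟨A, 2 * B' * C * 2, hA, by positivity, ?_⟩
  filter_upwards [hso.mem_nhds hxs] with y hy
  refine ⟨(ht _ (hs y hy).2).1.comp y (hs y hy).1.1, fun n => ?_⟩
  refine (norm_comp_le hto (fun z hz => (ht z hz).1.contDiffWithinAt) hso
    (fun z hz => (hs z hz).1.1.contDiffWithinAt) (fun z hz => (hs z hz).2) hy n).trans ?_
  have hMn := hM.pos n
  calc _ ≤ ∑ c : OrderedFinpartition n, A * (2 * B' * C) ^ n * wt M c := by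
        refine Finset.sum_le_sum fun c _ => ?_
        calc _ ≤ (A * B ^ c.length * c.length.factorial * M c.length) *
              ∏ i, (A' * (2 * B') ^ (c.partSize i) * (dw (c.partSize i) * M (c.partSize i))) := by
              gcongr with i
              · have := hM.pos c.length
                positivity
              · exact (ht _ (hs y hy).2).2 _
              · refine ((hs y hy).1.2 _).trans ?_
                obtain ⟨j, hj⟩ : ∃ j, c.partSize i = j + 1 :=
                  ⟨c.partSize i - 1, by have := c.partSize_pos i; omega⟩
                rw [hj]
                have h1 := fact_le_dw j
                have h2 := hM.pos (j + 1)
                have h3 := dw_pos (j + 1)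
                calc A' * B' ^ (j + 1) * ((j + 1).factorial : ℝ) * M (j + 1)
                    ≤ A' * B' ^ (j + 1) * (2 ^ j * dw (j + 1)) * M (j + 1) := by gcongr
                  _ ≤ A' * B' ^ (j + 1) * (2 ^ (j + 1) * dw (j + 1)) * M (j + 1) := by
                    gcongr <;> norm_num
                  _ = _ := by rw [mul_pow]; ring
          _ = A * (2 * B') ^ n * (B * A' * M 1) ^ c.length * wt M c := by
              rw [Finset.prod_mul_distrib, Finset.prod_mul_distrib, Finset.prod_const,
                Finset.prod_pow_eq_pow_sum, sum_partSize, Finset.card_univ, Fintype.card_fin]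
              unfold wt
              have : (M 1) ^ c.length * (M 1)⁻¹ ^ c.length = 1 := by
                rw [← mul_pow, mul_inv_cancel₀ hM1.ne', one_pow]
              rw [mul_pow (B * A') (M 1), mul_pow B A']
              linear_combination (-A * (2 * B') ^ n * B ^ c.length * A' ^ c.length *
                (c.length.factorial : ℝ) * M c.length *
                (∏ i, (dw (c.partSize i) * M (c.partSize i)))) * this
          _ ≤ A * (2 * B') ^ n * C ^ n * wt M c := by
              gcongr
              · exact wt_nonneg hM c
              · calc (B * A' * M 1) ^ c.length ≤ C ^ c.length := by
                      gcongr; exact le_max_right _ _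
                  _ ≤ C ^ n := pow_le_pow_right₀ hC1 c.length_le
          _ = _ := by rw [mul_pow _ C]; ring
    _ = A * (2 * B' * C) ^ n * ∑ c : OrderedFinpartition n, wt M c := by rw [Finset.mul_sum]
    _ ≤ A * (2 * B' * C) ^ n * (dw (n + 1) * M n) := by
      gcongr
      exact sum_wt_le hM n
    _ ≤ A * (2 * B' * C) ^ n * (2 ^ n * n.factorial * M n) := by
      gcongr
      exact dw_succ_le n
    _ = _ := by rw [mul_pow _ (2:ℝ)]; ring

theorem IsDCSeq.le_succ (hM : IsDCSeq M) (n : ℕ) : M n ≤ M 0 / M 1 * M (n + 1) := by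
  have h : M 1 / M 0 ≤ M (n + 1) / M n := hM.ratio_mono (Nat.zero_le n)
  have h0 := hM.pos 0
  have h1 := hM.pos 1
  have h2 := hM.pos n
  rw [div_le_div_iff₀ h0 h2] at h
  rw [div_mul_eq_mul_div, le_div_iff₀ h1]
  linarith

theorem IsDCSeq.succ_le (hM : IsDCSeq M) : ∃ C D : ℝ, 0 < C ∧ 0 < D ∧
    ∀ n, M (n + 1) ≤ D * C ^ n * M n := by
  obtain ⟨C, hC⟩ := hM.2.2.1
  have h0 := hM.pos 0
  have h1 := hM.pos 1
  have hpos : ∀ k, 0 < M (k + 1) / M k := fun k => div_pos (hM.pos _) (hM.pos _)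
  have hC0 : 0 < C := lt_of_lt_of_le (Real.rpow_pos_of_pos (hpos 1) _) (hC 1 le_rfl)
  refine ⟨C, max 1 (M 1 / M 0), hC0, by positivity, fun n => ?_⟩
  have hn := hM.pos n
  rw [← div_le_iff₀ hn]
  rcases Nat.eq_zero_or_pos n with rfl | h
  · simp
  · have h2 := hC n h
    have h3 : M (n + 1) / M n ≤ C ^ n := by
      have hn' : (n : ℝ) ≠ 0 := by positivity
      calc M (n + 1) / M n = ((M (n + 1) / M n) ^ ((1 : ℝ) / n)) ^ n := by
            rw [← Real.rpow_natCast, ← Real.rpow_mul (hpos n).le, one_div_mul_cancel hn',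
              Real.rpow_one]
        _ ≤ C ^ n := by
          gcongr
          exact Real.rpow_nonneg (hpos n).le _
    calc _ ≤ 1 * C ^ n := by rw [one_mul]; exact h3
      _ ≤ _ := by gcongr; exact le_max_left _ _

theorem DCAt.fderiv (hM : IsDCSeq M) {f : E → F} {x : E} (hf : DCAt M f x) :
    DCAt M (fderiv ℝ f) x := by
  obtain ⟨A, B, hA, hB, hf⟩ := hf
  obtain ⟨C, D, hC, hD, hCD⟩ := hM.succ_le
  refine ⟨A * B * D, B * 2 * C, by positivity, by positivity, ?_⟩
  filter_upwards [hf] with y hy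
  refine ⟨hy.1.fderiv_right (m := (⊤ : ℕ∞)) (by norm_cast), fun k => ?_⟩
  rw [norm_iteratedFDeriv_fderiv]
  refine (hy.2 (k + 1)).trans ?_
  have hk : ((k : ℝ) + 1) ≤ 2 ^ k := by exact_mod_cast (Nat.lt_two_pow_self (n := k))
  have hMk := hM.pos k
  have hMk1 := hM.pos (k + 1)
  rw [Nat.factorial_succ]
  push_cast
  calc A * B ^ (k + 1) * ((k + 1) * k.factorial) * M (k + 1)
      ≤ A * B ^ (k + 1) * (2 ^ k * k.factorial) * (D * C ^ k * M k) := by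
        gcongr
        exact hCD k
    _ = _ := by rw [mul_pow, mul_pow]; ring

theorem DCAt.of_fderiv (hM : IsDCSeq M) {f : E → F} {x : E}
    (hc : ∀ᶠ y in 𝓝 x, ContDiffAt ℝ (⊤ : ℕ∞) f y) (hf : DCAt M (_root_.fderiv ℝ f) x) :
    DCAt M f x := by
  obtain ⟨A, B, hA, hB, hf⟩ := hf
  have h0 := hM.pos 0
  have h1 := hM.pos 1
  set A' : ℝ := (‖f x‖ + 1) / M 0 + A * (M 0 / M 1) / B with hA'
  have hb : ∀ᶠ y in 𝓝 x, ‖f y‖ < ‖f x‖ + 1 :=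
    hc.self_of_nhds.continuousAt.norm.eventually (gt_mem_nhds (by linarith))
  refine ⟨A', B, by positivity, hB, ?_⟩
  filter_upwards [hc, hf, hb] with y hy hy2 hy3
  refine ⟨hy, fun k => ?_⟩
  rcases k with _ | k
  · rw [norm_iteratedFDeriv_zero]
    have : ‖f y‖ ≤ (‖f x‖ + 1) / M 0 * M 0 := by
      rw [div_mul_cancel₀ _ h0.ne']; exact hy3.le
    simp only [pow_zero, mul_one, Nat.factorial_zero, Nat.cast_one]
    refine this.trans ?_
    gcongr
    rw [hA']
    have : 0 ≤ A * (M 0 / M 1) / B := by positivity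
    linarith
  · rw [← norm_iteratedFDeriv_fderiv]
    refine (hy2.2 k).trans ?_
    have hk1 := hM.pos (k + 1)
    have hk0 := hM.pos k
    calc A * B ^ k * k.factorial * M k ≤ A * B ^ k * (k + 1).factorial * (M 0 / M 1 * M (k + 1)) := by
          gcongr
          · omega
          · exact hM.le_succ k
      _ = (A * (M 0 / M 1) / B) * B ^ (k + 1) * (k + 1).factorial * M (k + 1) := by
          rw [pow_succ]; field_simp
      _ ≤ _ := by
          gcongr
          rw [hA']
          have : 0 ≤ (‖f x‖ + 1) / M 0 := by positivity
          linarith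

theorem DCAt.const (hM : IsDCSeq M) (c : F) (x : E) : DCAt M (fun _ => c) x := by
  have h0 := hM.pos 0
  refine ⟨(‖c‖ + 1) / M 0, 1, by positivity, one_pos, Eventually.of_forall fun y =>
    ⟨contDiffAt_const, fun k => ?_⟩⟩
  rcases k with _ | k
  · rw [norm_iteratedFDeriv_zero]
    simp only [pow_zero, mul_one, Nat.factorial_zero, Nat.cast_one]
    rw [div_mul_cancel₀ _ h0.ne']
    linarith
  · rw [iteratedFDeriv_succ_const]
    have := hM.pos (k + 1)
    simp only [Pi.zero_apply, norm_zero]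
    positivity

theorem DCAt.clm (hM : IsDCSeq M) (L : E →L[ℝ] F) (x : E) : DCAt M L x := by
  refine DCAt.of_fderiv hM (Eventually.of_forall fun y => L.contDiff.contDiffAt) ?_
  have : _root_.fderiv ℝ L = fun _ => L := by
    ext1 y; exact L.fderiv
  rw [this]
  exact DCAt.const hM _ _

theorem DCAt.clm_comp (hM : IsDCSeq M) (L : F →L[ℝ] G) {f : E → F} {x : E} (hf : DCAt M f x) :
    DCAt M (fun y => L (f y)) x :=
  DCAt.comp hM (DCAt.clm hM L (f x)) hf

theorem DCAt.add (hM : IsDCSeq M) {f g : E → F} {x : E} (hf : DCAt M f x) (hg : DCAt M g x) :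
    DCAt M (fun y => f y + g y) x := by
  obtain ⟨A, B, hA, hB, hf⟩ := hf
  obtain ⟨A', B', hA', hB', hg⟩ := hg
  refine ⟨A + A', max B B', by positivity, by positivity, ?_⟩
  filter_upwards [hf, hg] with y hy hy2
  refine ⟨hy.1.add hy2.1, fun k => ?_⟩
  have h := iteratedFDeriv_add_apply (𝕜 := ℝ) (i := k) (hy.1.of_le (by exact_mod_cast le_top))
    (hy2.1.of_le (by exact_mod_cast le_top))
  change ‖iteratedFDeriv ℝ k (f + g) y‖ ≤ _
  rw [h]
  have := hM.pos k
  calc _ ≤ _ := norm_add_le _ _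
    _ ≤ _ := add_le_add (hy.2 k) (hy2.2 k)
    _ ≤ A * (max B B') ^ k * k.factorial * M k + A' * (max B B') ^ k * k.factorial * M k := by
      gcongr
      · exact le_max_left _ _
      · exact le_max_right _ _
    _ = _ := by ring

theorem DCAt.prodMk (hM : IsDCSeq M) {f : E → F} {g : E → G} {x : E} (hf : DCAt M f x)
    (hg : DCAt M g x) : DCAt M (fun y => (f y, g y)) x := by
  have := DCAt.add hM (hf.clm_comp hM (ContinuousLinearMap.inl ℝ F G))
    (hg.clm_comp hM (ContinuousLinearMap.inr ℝ F G))
  simpa using this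

theorem DCAt.smul (hM : IsDCSeq M) {f : E → ℝ} {g : E → F} {x : E} (hf : DCAt M f x)
    (hg : DCAt M g x) : DCAt M (fun y => f y • g y) x := by
  have hb : IsBoundedBilinearMap ℝ (fun p : ℝ × F => p.1 • p.2) := isBoundedBilinearMap_smul
  have h1 : DCAt M (fun p : ℝ × F => p.1 • p.2) (f x, g x) := by
    refine DCAt.of_fderiv hM (Eventually.of_forall fun y => hb.contDiff.contDiffAt) ?_
    have h2 := hb.isBoundedLinearMap_deriv
    have h3 : _root_.fderiv ℝ (fun p : ℝ × F => p.1 • p.2) = h2.toContinuousLinearMap := by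
      ext1 y
      exact hb.fderiv y
    rw [h3]
    exact DCAt.clm hM _ _
  exact DCAt.comp hM (g := fun y => (f y, g y)) h1 (hf.prodMk hM hg)

theorem DCAt.ode (hM : IsDCSeq M) {γ : E → F} {x : E} {K : F → (E →L[ℝ] F)}
    (hγ : ∀ᶠ y in 𝓝 x, ContDiffAt ℝ (⊤ : ℕ∞) γ y) (hK : DCAt M K (γ x))
    (hode : ∀ᶠ y in 𝓝 x, _root_.fderiv ℝ γ y = K (γ y)) : DCAt M γ x := by
  have hγc := hγ.self_of_nhds.continuousAt
  obtain ⟨A, B, hA, hB, hK⟩ := hK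
  obtain ⟨t, ht, hto, hxt⟩ := eventually_nhds_iff.1 hK
  obtain ⟨s, hs, hso, hxs⟩ := eventually_nhds_iff.1
    ((hγ.and hode).and (hγc.eventually (hto.mem_nhds hxt)))
  have hM0 := hM.pos 0
  have hM1 := hM.pos 1
  set τ : ℝ := (B * M 1)⁻¹ with hτ
  set S : ℝ := A * B * M 0 with hS
  have hτ0 : 0 < τ := by positivity
  have hS0 : 0 < S := by positivity
  have main : ∀ y ∈ s, ∀ n, 1 ≤ n → ‖iteratedFDeriv ℝ n γ y‖ ≤ τ * S ^ n * (dw n * M n) := by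
    intro y hy n
    induction n using Nat.strong_induction_on with
    | _ n ih =>
    intro hn
    obtain ⟨n, rfl⟩ : ∃ m, n = m + 1 := ⟨n - 1, by omega⟩
    rw [← norm_iteratedFDeriv_fderiv]
    have heq : _root_.fderiv ℝ γ =ᶠ[𝓝 y] K ∘ γ := by
      filter_upwards [hso.mem_nhds hy] with z hz using (hs z hz).1.2
    rw [(heq.iteratedFDeriv ℝ n).eq_of_nhds]
    refine (norm_comp_le hto (fun z hz => (ht z hz).1.contDiffWithinAt) hso
      (fun z hz => (hs z hz).1.1.contDiffWithinAt) (fun z hz => (hs z hz).2) hy n).trans ?_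
    have hMn := hM.pos n
    have hdn := dw_pos (n + 1)
    calc _ ≤ ∑ c : OrderedFinpartition n, A * S ^ n * wt M c := by
          refine Finset.sum_le_sum fun c _ => ?_
          calc _ ≤ (A * B ^ c.length * c.length.factorial * M c.length) *
                ∏ i, (τ * S ^ (c.partSize i) * (dw (c.partSize i) * M (c.partSize i))) := by
                gcongr with i
                · have := hM.pos c.length
                  positivity
                · exact (ht _ (hs y hy).2).2 _
                · exact ih _ (Nat.lt_succ_of_le (c.partSize_le i)) (c.partSize_pos i)
            _ = A * S ^ n * wt M c := by
                rw [Finset.prod_mul_distrib, Finset.prod_mul_distrib, Finset.prod_const,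
                  Finset.prod_pow_eq_pow_sum, sum_partSize, Finset.card_univ, Fintype.card_fin]
                unfold wt
                have : B ^ c.length * τ ^ c.length = (M 1)⁻¹ ^ c.length := by
                  rw [← mul_pow, hτ]
                  congr 1
                  field_simp
                rw [← this]
                ring
      _ = A * S ^ n * ∑ c : OrderedFinpartition n, wt M c := by rw [Finset.mul_sum]
      _ ≤ A * S ^ n * (dw (n + 1) * M n) := by
        gcongr
        exact sum_wt_le hM n
      _ ≤ A * S ^ n * (dw (n + 1) * (M 0 / M 1 * M (n + 1))) := by
        gcongr
        exact hM.le_succ n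
      _ = _ := by
        rw [pow_succ, hτ, hS]
        field_simp
  have hb : ∀ᶠ y in 𝓝 x, ‖γ y‖ < ‖γ x‖ + 1 :=
    hγc.norm.eventually (gt_mem_nhds (by linarith))
  refine ⟨τ + (‖γ x‖ + 1) / M 0, S * 2, by positivity, by positivity, ?_⟩
  filter_upwards [hso.mem_nhds hxs, hb] with y hy hy2
  refine ⟨(hs y hy).1.1, fun k => ?_⟩
  have hMk := hM.pos k
  rcases k with _ | k
  · rw [norm_iteratedFDeriv_zero]
    have : ‖γ y‖ ≤ (‖γ x‖ + 1) / M 0 * M 0 := by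
      rw [div_mul_cancel₀ _ hM0.ne']; exact hy2.le
    simp only [pow_zero, mul_one, Nat.factorial_zero, Nat.cast_one]
    refine this.trans ?_
    gcongr
    linarith
  · refine (main y hy (k + 1) (by omega)).trans ?_
    calc τ * S ^ (k + 1) * (dw (k + 1) * M (k + 1))
        ≤ τ * S ^ (k + 1) * ((2 ^ (k + 1) * (k + 1).factorial) * M (k + 1)) := by
          gcongr
          refine (dw_succ_le k).trans ?_
          gcongr
          · norm_num
          · omega
          · omega
      _ = τ * (S * 2) ^ (k + 1) * (k + 1).factorial * M (k + 1) := by rw [mul_pow]; ring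
      _ ≤ _ := by
          gcongr
          have : 0 ≤ (‖γ x‖ + 1) / M 0 := by positivity
          linarith

theorem DCAt.inv_real (hM : IsDCSeq M) {a : ℝ} (ha : a ≠ 0) :
    DCAt M (fun t : ℝ => t⁻¹) a := by
  have hne : ∀ᶠ t : ℝ in 𝓝 a, t ≠ 0 := isOpen_ne.mem_nhds ha
  refine DCAt.ode hM (K := fun z : ℝ => (ContinuousLinearMap.toSpanSingletonCLE (𝕜 := ℝ) (E := ℝ)
    : ℝ →L[ℝ] (ℝ →L[ℝ] ℝ)) (-(z • z))) ?_ ?_ ?_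
  · filter_upwards [hne] with t ht using contDiffAt_inv ℝ ht
  · have hid : DCAt M (fun z : ℝ => z) a⁻¹ := DCAt.clm hM (ContinuousLinearMap.id ℝ ℝ) _
    exact (((hid.smul hM hid).clm_comp hM (-ContinuousLinearMap.id ℝ ℝ)).clm_comp hM
      (ContinuousLinearMap.toSpanSingletonCLE (𝕜 := ℝ) (E := ℝ) : ℝ →L[ℝ] (ℝ →L[ℝ] ℝ)))
  · filter_upwards [hne] with t ht
    have := (hasDerivAt_inv ht).hasFDerivAt.fderiv
    rw [this]
    ext
    simp
    field_simp

theorem DCAt.iteratedFDeriv (hM : IsDCSeq M) {f : E → F} {x : E} (hf : DCAt M f x) (m : ℕ) :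
    DCAt M (iteratedFDeriv ℝ m f) x := by
  induction m with
  | zero =>
    rw [iteratedFDeriv_zero_eq_comp]
    exact hf.clm_comp hM
      (continuousMultilinearCurryFin0 ℝ E F).symm.toContinuousLinearEquiv.toContinuousLinearMap
  | succ m ih =>
    rw [iteratedFDeriv_succ_eq_comp_left]
    exact (ih.fderiv hM).clm_comp hM
      (continuousMultilinearCurryLeftEquiv ℝ
        (fun _ : Fin (m + 1) => E) F).symm.toContinuousLinearEquiv.toContinuousLinearMap

end QDC

namespace QDC
open Filter Topology Finset

variable {E F G : Type*} [NormedAddCommGroup E] [NormedSpace ℝ E] [NormedAddCommGroup F]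
  [NormedSpace ℝ F] [NormedAddCommGroup G] [NormedSpace ℝ G] {M : ℕ → ℝ}

theorem isInvertible_real {L : ℝ →L[ℝ] ℝ} (h : L 1 ≠ 0) : L.IsInvertible := by
  refine ⟨ContinuousLinearEquiv.unitsEquivAut ℝ (Units.mk0 (L 1) h), ?_⟩
  ext
  simp

theorem implicit (hM : IsDCSeq M) [CompleteSpace E] {g : E × ℝ → ℝ} {u : E × ℝ}
    (hg : DCAt M g u) (h0 : g u = 0) (hd : fderiv ℝ g u (0, 1) ≠ 0) :
    ∃ φ : E → ℝ, DCAt M φ u.1 ∧ φ u.1 = u.2 ∧ ∀ᶠ v in 𝓝 u, g v = 0 → v.2 = φ v.1 := by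
  have hinv : ∀ v, fderiv ℝ g v (0, 1) ≠ 0 →
      (fderiv ℝ g v ∘L .inr ℝ E ℝ).IsInvertible := by
    intro v hv
    apply isInvertible_real
    simpa using hv
  have htop : ((⊤ : ℕ∞) : WithTop ℕ∞) ≠ 0 := by simp
  set φ := hg.contDiffAt.implicitFunction htop (hinv u hd) with hφ
  have hself : φ u.1 = u.2 := hg.contDiffAt.implicitFunction_apply_self htop (hinv u hd)
  have hsol : ∀ᶠ x in 𝓝 u.1, g (x, φ x) = g u :=
    hg.contDiffAt.eventually_apply_implicitFunction htop (hinv u hd)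
  have hiff : ∀ᶠ v in 𝓝 u, g v = g u ↔ φ v.1 = v.2 :=
    hg.contDiffAt.eventually_apply_eq_iff_implicitFunction htop (hinv u hd)
  have hcd : ContDiffAt ℝ (⊤ : ℕ∞) φ u.1 :=
    hg.contDiffAt.contDiffAt_implicitFunction htop (hinv u hd)
  have hcont : ∀ᶠ x in 𝓝 u.1, ContDiffAt ℝ 1 φ x :=
    (hcd.of_le (m := 1) (by exact_mod_cast le_top)).eventually (by simp)
  have hγt : Tendsto (fun x => (x, φ x)) (𝓝 u.1) (𝓝 u) := by
    have : ContinuousAt (fun x => (x, φ x)) u.1 := continuousAt_id.prodMk hcd.continuousAt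
    have h2 := this.tendsto
    rwa [hself] at h2
  have hdg := (hg.fderiv hM).continuousAt
  have hne : ∀ᶠ v in 𝓝 u, fderiv ℝ g v (0, 1) ≠ 0 :=
    (hdg.clm_apply continuousAt_const).eventually (isOpen_ne.mem_nhds hd)
  have hsm : ∀ᶠ y in 𝓝 u.1, ContDiffAt ℝ (⊤ : ℕ∞) φ y := by
    filter_upwards [hγt.eventually hg.eventually, hγt.eventually hne, hcont,
      hsol.eventually_nhds] with y hgy hny hcy hsy
    have h1 := hgy.contDiffAt.eventually_apply_eq_iff_implicitFunction htop (hinv _ hny)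
    have h2 := hgy.contDiffAt.contDiffAt_implicitFunction htop (hinv _ hny)
    have h3 : ContinuousAt (fun x => (x, φ x)) y := continuousAt_id.prodMk hcy.continuousAt
    refine h2.congr_of_eventuallyEq ?_
    filter_upwards [h3.eventually h1, hsy] with z hz hz2
    exact (hz.1 (hz2.trans hsy.self_of_nhds.symm)).symm
  refine ⟨φ, ?_, hself, ?_⟩
  · let a : E × ℝ → ℝ := fun v => fderiv ℝ g v (0, 1)
    let b : E × ℝ → (E →L[ℝ] ℝ) := fun v => (fderiv ℝ g v) ∘L .inl ℝ E ℝ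
    let K : E × ℝ → (E →L[ℝ] E × ℝ) := fun v =>
      .inl ℝ E ℝ + (.inr ℝ E ℝ) ∘L ((a v)⁻¹ • (-(b v)))
    have ha : DCAt M a u :=
      (hg.fderiv hM).clm_comp hM (ContinuousLinearMap.apply ℝ ℝ ((0, 1) : E × ℝ))
    have hb : DCAt M (fun v => - b v) u :=
      ((hg.fderiv hM).clm_comp hM ((ContinuousLinearMap.compL ℝ E (E × ℝ) ℝ).flip
        (.inl ℝ E ℝ))).clm_comp hM (-ContinuousLinearMap.id ℝ _)
    have hai : DCAt M (fun v => (a v)⁻¹) u := DCAt.comp hM (DCAt.inv_real hM hd) ha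
    have hK : DCAt M K u := (DCAt.const hM _ _).add hM
      ((hai.smul hM hb).clm_comp hM (ContinuousLinearMap.compL ℝ E ℝ (E × ℝ) (.inr ℝ E ℝ)))
    have hγ : DCAt M (fun x => (x, φ x)) u.1 := by
      refine DCAt.ode hM (K := K) ?_ ?_ ?_
      · filter_upwards [hsm] with y hy using contDiffAt_id.prodMk hy
      · rw [hself]; exact hK
      · filter_upwards [hsm, hγt.eventually hg.eventually, hγt.eventually hne,
          hsol.eventually_nhds] with y hy hgy hny hsy
        have hφd : HasFDerivAt φ (fderiv ℝ φ y) y := (hy.differentiableAt htop).hasFDerivAt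
        have hγd : HasFDerivAt (fun x => (x, φ x)) ((ContinuousLinearMap.id ℝ E).prod
          (fderiv ℝ φ y)) y := (hasFDerivAt_id y).prodMk hφd
        have hgd : HasFDerivAt g (fderiv ℝ g (y, φ y)) (y, φ y) :=
          (hgy.contDiffAt.differentiableAt htop).hasFDerivAt
        have hcomp := hgd.comp y hγd
        have hz : HasFDerivAt (g ∘ fun x => (x, φ x)) (0 : E →L[ℝ] ℝ) y := by
          refine (hasFDerivAt_const (g u) y).congr_of_eventuallyEq ?_
          filter_upwards [hsy] with z hz using hz
        have heq := hcomp.unique hz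
        rw [hγd.fderiv]
        ext h
        · simp [K]
        · have h1 := congrArg (fun L : E →L[ℝ] ℝ => L h) heq
          simp only [ContinuousLinearMap.comp_apply, ContinuousLinearMap.prod_apply,
            ContinuousLinearMap.id_apply, ContinuousLinearMap.zero_apply] at h1
          have h2 : ((h, fderiv ℝ φ y h) : E × ℝ) = (h, 0) + (fderiv ℝ φ y h) • ((0, 1) : E × ℝ) := by
            simp
          rw [h2, map_add, map_smul] at h1
          simp [K, a, b]
          field_simp
          simp at h1
          linarith
    exact hγ.clm_comp hM (.snd ℝ E ℝ)
  · filter_upwards [hiff] with v hv hv0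
    exact (hv.1 (by rw [hv0, h0])).symm

theorem bang_step {m : ℕ → ℝ} (hm : ∀ k, 0 < m k) (hmono : Monotone fun k => m (k + 1) / m k)
    {f : ℕ → ℝ → ℝ}
    (hf : ∀ k, ∀ t ∈ Set.Icc (0:ℝ) 1, HasDerivAt (f k) (f (k + 1) t) t)
    (hb : ∀ k, ∀ t ∈ Set.Icc (0:ℝ) 1, |f k t| ≤ m k) (p : ℕ) {x y : ℝ} (hx : 0 ≤ x) (hxy : x ≤ y)
    (hy : y ≤ 1) (hd : y - x ≤ m p / m (p + 1) / Real.exp 1)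
    (hP : ∀ n : ℕ, |f n x| ≤ Real.exp (-((p + 1 : ℕ) : ℝ)) * Real.exp n * m n) :
    ∀ n : ℕ, |f n y| ≤ Real.exp (-(p : ℝ)) * Real.exp n * m n := by
  set q := Real.exp (-((p + 1 : ℕ) : ℝ)) with hq
  set a := Real.exp 1 * (m (p + 1) / m p) with ha
  have hmp := hm p
  have hmp1 := hm (p + 1)
  have ha0 : 0 < a := by positivity
  have hq0 : 0 < q := Real.exp_pos _
  have key : ∀ i : ℕ, ∀ n : ℕ, n + i = p + 1 → ∀ s ∈ Set.Icc x 1,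
      |f n s| ≤ q * Real.exp n * m n * Real.exp (a * (s - x)) := by
    intro i
    induction i with
    | zero =>
      intro n hn s hs
      obtain rfl : n = p + 1 := by omega
      refine (hb _ s ⟨hx.trans hs.1, hs.2⟩).trans ?_
      have h1 : q * Real.exp ((p + 1 : ℕ) : ℝ) = 1 := by
        rw [hq, ← Real.exp_add]; simp
      rw [h1, one_mul]
      exact le_mul_of_one_le_right hmp1.le
        (Real.one_le_exp (mul_nonneg ha0.le (sub_nonneg.2 hs.1)))
    | succ i ih =>
      intro n hn s hs
      have hmn := hm n
      have hmn1 := hm (n + 1)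
      have hsub : ∀ t ∈ Set.Icc x 1, t ∈ Set.Icc (0:ℝ) 1 := fun t ht => ⟨hx.trans ht.1, ht.2⟩
      have := image_norm_le_of_norm_deriv_right_le_deriv_boundary (f := f n) (f' := f (n + 1))
        (a := x) (b := 1) (B := fun s => q * Real.exp n * m n * Real.exp (a * (s - x)))
        (B' := fun s => q * Real.exp n * m n * (Real.exp (a * (s - x)) * a))
        (fun t ht => (hf n t (hsub t ht)).continuousAt.continuousWithinAt)
        (fun t ht => (hf n t (hsub t ⟨ht.1, ht.2.le⟩)).hasDerivWithinAt)
        (by simpa using hP n)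
        (fun t => by
          have h1 : HasDerivAt (fun s => a * (s - x)) a t := by
            simpa using ((hasDerivAt_id t).sub_const x).const_mul a
          exact (h1.exp).const_mul _)
        (fun t ht => by
          refine (ih (n + 1) (by omega) t ⟨ht.1, ht.2.le⟩).trans ?_
          have h2 : m (n + 1) / m n ≤ m (p + 1) / m p := hmono (by omega)
          have h3 : m (n + 1) ≤ m n * (m (p + 1) / m p) := by
            rw [div_le_iff₀ hmn] at h2; linarith
          calc q * Real.exp ((n + 1 : ℕ) : ℝ) * m (n + 1) * Real.exp (a * (t - x))
              ≤ q * Real.exp ((n + 1 : ℕ) : ℝ) * (m n * (m (p + 1) / m p)) *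
                  Real.exp (a * (t - x)) := by gcongr
            _ = _ := by
              rw [ha]; push_cast; rw [Real.exp_add]; ring)
      exact this hs
  intro n
  have hmn := hm n
  by_cases hn : n ≤ p + 1
  · refine (key (p + 1 - n) n (by omega) y ⟨hxy, hy⟩).trans ?_
    have h1 : a * (y - x) ≤ 1 := by
      calc a * (y - x) ≤ a * (m p / m (p + 1) / Real.exp 1) := by gcongr
        _ = 1 := by rw [ha]; field_simp
    calc q * Real.exp n * m n * Real.exp (a * (y - x)) ≤ q * Real.exp n * m n * Real.exp 1 := by
          gcongr
      _ = (q * Real.exp 1) * Real.exp n * m n := by ring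
      _ = _ := by
        congr 2
        rw [hq, ← Real.exp_add]
        congr 1
        push_cast; ring
  · refine (hb n y ⟨hx.trans hxy, hy⟩).trans ?_
    refine le_mul_of_one_le_left hmn.le ?_
    rw [← Real.exp_add]
    apply Real.one_le_exp
    have : (p : ℝ) ≤ n := by exact_mod_cast (by omega : p ≤ n)
    linarith

theorem bang {m : ℕ → ℝ} (hm : ∀ k, 0 < m k) (hmono : Monotone fun k => m (k + 1) / m k)
    (hdiv : ¬ Summable fun k => m k / m (k + 1)) {f : ℕ → ℝ → ℝ}
    (hf : ∀ k, ∀ t ∈ Set.Icc (0:ℝ) 1, HasDerivAt (f k) (f (k + 1) t) t)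
    (hb : ∀ k, ∀ t ∈ Set.Icc (0:ℝ) 1, |f k t| ≤ m k) (h0 : ∀ k, f k 0 = 0) : f 0 1 = 0 := by
  set δ : ℕ → ℝ := fun p => m p / m (p + 1) / Real.exp 1 with hδ
  have hδ0 : ∀ p, 0 ≤ δ p := fun p => by
    have := hm p
    have := hm (p + 1)
    simp only [hδ]; positivity
  have prop : ∀ i k : ℕ, ∀ x ∈ Set.Icc (0:ℝ) 1, x ≤ ∑ j ∈ Finset.range i, δ (j + k) →
      ∀ n : ℕ, |f n x| ≤ Real.exp (-(k : ℝ)) * Real.exp n * m n := by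
    intro i
    induction i with
    | zero =>
      intro k x hx hxs n
      have : x = 0 := le_antisymm (by simpa using hxs) hx.1
      subst this
      have := hm n
      rw [h0]
      simp only [abs_zero]
      positivity
    | succ i ih =>
      intro k x hx hxs
      rw [Finset.sum_range_succ'] at hxs
      simp only [zero_add] at hxs
      have hs : 0 ≤ ∑ j ∈ Finset.range i, δ (j + 1 + k) := Finset.sum_nonneg fun j _ => hδ0 _
      refine bang_step hm hmono hf hb k (x := max 0 (x - δ k)) (le_max_left _ _)
        (max_le hx.1 (by linarith [hδ0 k])) hx.2 ?_ ?_
      · have := le_max_right 0 (x - δ k)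
        change _ ≤ δ k
        linarith
      · refine ih (k + 1) _ ⟨le_max_left _ _, max_le zero_le_one (by linarith [hδ0 k, hx.2])⟩ ?_
        have he : ∑ j ∈ Finset.range i, δ (j + (k + 1)) = ∑ j ∈ Finset.range i, δ (j + 1 + k) :=
          Finset.sum_congr rfl fun j _ => by congr 1; ring
        rw [he]
        exact max_le hs (by linarith)
  have hall : ∀ k : ℕ, |f 0 1| ≤ Real.exp (-(k : ℝ)) * m 0 := by
    intro k
    have hns : ¬ Summable fun j => δ (j + k) := by
      rw [summable_nat_add_iff k]
      intro h
      apply hdiv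
      have := h.mul_right (Real.exp 1)
      refine this.congr fun p => ?_
      simp only [hδ]
      field_simp
    have ht := (not_summable_iff_tendsto_nat_atTop_of_nonneg (fun j => hδ0 (j + k))).1 hns
    obtain ⟨i, hi⟩ := (ht.eventually_ge_atTop 1).exists
    have := prop i k 1 (by simp) hi 0
    simpa using this
  have hlim : Tendsto (fun k : ℕ => Real.exp (-(k : ℝ)) * m 0) atTop (𝓝 0) := by
    have h1 : Tendsto (fun k : ℕ => Real.exp (-(k : ℝ))) atTop (𝓝 0) :=
      Real.tendsto_exp_neg_atTop_nhds_zero.comp tendsto_natCast_atTop_atTop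
    simpa using h1.mul_const (m 0)
  have := ge_of_tendsto' hlim hall
  exact abs_eq_zero.1 (le_antisymm this (abs_nonneg _))

theorem quasi (hM : IsDCSeq M) {h : E → ℝ} {p : E} (hh : DCAt M h p)
    (hflat : ∀ k, iteratedFDeriv ℝ k h p = 0) : ∀ᶠ y in 𝓝 p, h y = 0 := by
  obtain ⟨A, B, hA, hB, hh⟩ := hh
  obtain ⟨r, hr, hball⟩ := Metric.eventually_nhds_iff_ball.1 hh
  have hr' : 0 < min r 1 := by positivity
  filter_upwards [Metric.ball_mem_nhds p hr'] with y hy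
  set v := y - p with hv
  have hv1 : ‖v‖ < min r 1 := by rwa [mem_ball_iff_norm] at hy
  set m : ℕ → ℝ := fun k => A * B ^ k * k.factorial * M k with hm
  have hmpos : ∀ k, 0 < m k := fun k => by
    have := hM.pos k
    simp only [hm]; positivity
  have hratio : ∀ k, m (k + 1) / m k = B * (k + 1) * (M (k + 1) / M k) := fun k => by
    have := hM.pos k
    simp only [hm, Nat.factorial_succ, pow_succ]
    push_cast
    field_simp
  have hmem : ∀ t ∈ Set.Icc (0:ℝ) 1, p + t • v ∈ Metric.ball p r := by
    intro t ht
    rw [mem_ball_iff_norm, add_sub_cancel_left, norm_smul, Real.norm_eq_abs, abs_of_nonneg ht.1]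
    calc t * ‖v‖ ≤ 1 * ‖v‖ := by gcongr; exact ht.2
      _ < r := by rw [one_mul]; exact hv1.trans_le (min_le_left _ _)
  have := bang (m := m) hmpos ?_ ?_
    (f := fun k t => iteratedFDeriv ℝ k h (p + t • v) (fun _ => v)) ?_ ?_ ?_
  · simpa [hv] using this
  · intro k l hkl
    simp only [hratio]
    have h1 : M (k + 1) / M k ≤ M (l + 1) / M l := hM.ratio_mono hkl
    have h2 : 0 < M (k + 1) / M k := div_pos (hM.pos _) (hM.pos _)
    have h3 : (k : ℝ) ≤ l := by exact_mod_cast hkl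
    gcongr
  · intro hs
    apply hM.2.2.2
    refine (hs.mul_left B).congr fun k => ?_
    have h1 : m k / m (k + 1) = (B * (k + 1) * (M (k + 1) / M k))⁻¹ := by
      rw [← hratio, inv_div]
    rw [h1]
    have := hM.pos k
    have := hM.pos (k + 1)
    field_simp
  · intro k t ht
    have hc := (hball _ (hmem t ht)).1
    have h1 : HasFDerivAt (iteratedFDeriv ℝ k h) (fderiv ℝ (iteratedFDeriv ℝ k h) (p + t • v))
        (p + t • v) :=
      (hc.differentiableAt_iteratedFDeriv (m := k) (by exact_mod_cast ENat.coe_lt_top k)).hasFDerivAt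
    have h2 : HasDerivAt (fun t : ℝ => p + t • v) v t := by
      simpa using ((hasDerivAt_id t).smul_const v).const_add p
    have h3 := h1.comp_hasDerivAt t h2
    have h4 := (ContinuousMultilinearMap.apply ℝ (fun _ : Fin k => E) ℝ
      (fun _ => v)).hasFDerivAt.comp_hasDerivAt t h3
    have h5 : iteratedFDeriv ℝ (k + 1) h (p + t • v) (fun _ => v) =
      (ContinuousMultilinearMap.apply ℝ (fun _ : Fin k => E) ℝ (fun _ => v))
        ((fderiv ℝ (iteratedFDeriv ℝ k h) (p + t • v)) v) := by
      rw [iteratedFDeriv_succ_apply_left]; rfl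
    rw [h5]
    exact h4
  · intro k t ht
    have hbk := (hball _ (hmem t ht)).2 k
    rw [← Real.norm_eq_abs]
    refine (ContinuousMultilinearMap.le_opNorm _ _).trans ?_
    simp only [Finset.prod_const, Finset.card_univ, Fintype.card_fin]
    have : ‖v‖ ^ k ≤ 1 := pow_le_one₀ (norm_nonneg _) (hv1.le.trans (min_le_right _ _))
    calc _ ≤ ‖iteratedFDeriv ℝ k h (p + t • v)‖ * 1 := by gcongr
      _ ≤ _ := by rw [mul_one]; exact hbk
  · intro k
    simp [hflat]

end QDC

namespace QDC
open Filter Topology Finset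

variable {σ : Type*} [Fintype σ] [DecidableEq σ] {M : ℕ → ℝ}

theorem foldr_ofFn {f : (σ → ℝ) → ℝ} {V : Set (σ → ℝ)} (hV : IsOpen V)
    (hf : ContDiffOn ℝ (⊤ : ℕ∞) f V) : ∀ (k : ℕ) (s : Fin k → σ), ∀ y ∈ V,
      (List.ofFn s).foldr pd f y
        = iteratedFDeriv ℝ k f y (fun j => Pi.single (s j) 1) := by
  intro k
  induction k with
  | zero => intro s y hy; simp
  | succ k ih =>
    intro s y hy
    rw [List.ofFn_succ, List.foldr_cons, iteratedFDeriv_succ_apply_left]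
    have h1 : (List.ofFn fun i : Fin k => s i.succ).foldr pd f =ᶠ[𝓝 y]
        fun z => iteratedFDeriv ℝ k f z (fun j => Pi.single (s j.succ) 1) := by
      filter_upwards [hV.mem_nhds hy] with z hz
      exact ih _ z hz
    have hd : DifferentiableAt ℝ (iteratedFDeriv ℝ k f) y := by
      apply (hf.contDiffAt (hV.mem_nhds hy)).differentiableAt_iteratedFDeriv
      exact_mod_cast ENat.natCast_lt_top k
    unfold pd at h1 ⊢
    rw [h1.fderiv_eq, fderiv_continuousMultilinear_apply_const_apply hd]
    rfl

theorem contDiffOn_foldr {f : (σ → ℝ) → ℝ} {V : Set (σ → ℝ)} (hV : IsOpen V)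
    (hf : ContDiffOn ℝ (⊤ : ℕ∞) f V) (l : List σ) :
    ContDiffOn ℝ (⊤ : ℕ∞) (l.foldr pd f) V := by
  induction l with
  | nil => exact hf
  | cons i l ih =>
    have := ih.fderiv_of_isOpen (m := (⊤ : ℕ∞)) hV (by simp)
    exact this.clm_apply contDiffOn_const

theorem foldr_perm {f : (σ → ℝ) → ℝ} {V : Set (σ → ℝ)} (hV : IsOpen V)
    (hf : ContDiffOn ℝ (⊤ : ℕ∞) f V) {l l' : List σ} (h : l.Perm l') :
    ∀ y ∈ V, l.foldr pd f y = l'.foldr pd f y := by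
  induction h with
  | nil => simp
  | cons i h ih =>
    intro y hy
    have : _ =ᶠ[𝓝 y] _ := Filter.eventually_of_mem (hV.mem_nhds hy) ih
    simp only [List.foldr_cons]
    change fderiv ℝ _ y _ = fderiv ℝ _ y _
    rw [this.fderiv_eq (𝕜 := ℝ)]
  | swap i j l =>
    intro y hy
    have hg := (contDiffOn_foldr hV hf l).contDiffAt (hV.mem_nhds hy)
    have hs : IsSymmSndFDerivAt ℝ (l.foldr pd f) y :=
      hg.isSymmSndFDerivAt (by simpa using WithTop.coe_le_coe.2 (le_top : (2 : ℕ∞) ≤ ⊤))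
    have hd : DifferentiableAt ℝ (fderiv ℝ (l.foldr pd f)) y :=
      (hg.fderiv_right (m := 1) (by norm_cast)).differentiableAt (by simp)
    simp only [List.foldr_cons]
    have key : ∀ a b : σ, pd a (pd b (l.foldr pd f)) y
        = fderiv ℝ (fderiv ℝ (l.foldr pd f)) y (Pi.single a 1) (Pi.single b 1) := by
      intro a b
      generalize l.foldr pd f = g at hd
      unfold pd
      rw [fderiv_clm_apply hd (differentiableAt_const _)]
      simp
    rw [key, key]
    exact hs _ _
  | trans _ _ h1 h2 => intro y hy; rw [h1 y hy, h2 y hy]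

/-- list of coordinates of a multiindex -/
noncomputable def mlist (α : σ → ℕ) : List σ :=
  (Finset.univ : Finset σ).toList.flatMap fun i => List.replicate (α i) i

theorem mpd_eq (α : σ → ℕ) (f : (σ → ℝ) → ℝ) : mpd α f = (mlist α).foldr pd f := by
  unfold mpd mlist
  induction (Finset.univ : Finset σ).toList with
  | nil => rfl
  | cons i l ih =>
    rw [List.foldr_cons, ih, List.flatMap_cons, List.foldr_append]
    generalize List.foldr pd f _ = g
    induction α i with
    | zero => rfl
    | succ k ih2 => rw [Function.iterate_succ_apply', ih2, List.replicate_succ, List.foldr_cons]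

theorem count_mlist (α : σ → ℕ) (a : σ) : (mlist α).count a = α a := by
  unfold mlist
  rw [List.count_flatMap]
  simp only [Function.comp_def, List.count_replicate]
  rw [Finset.sum_map_toList]
  simp

theorem length_mlist (α : σ → ℕ) : (mlist α).length = mdeg α := by
  unfold mlist mdeg
  rw [List.length_flatMap]
  simp [Finset.sum_map_toList]

theorem norm_multilinear_le {k : ℕ} (T : ContinuousMultilinearMap ℝ (fun _ : Fin k => σ → ℝ) ℝ)
    {C : ℝ} (hC : 0 ≤ C) (h : ∀ s : Fin k → σ, |T (fun j => Pi.single (s j) 1)| ≤ C) :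
    ‖T‖ ≤ (Fintype.card σ : ℝ) ^ k * C := by
  apply T.opNorm_le_bound (by positivity)
  intro v
  have h1 : v = fun j => ∑ i, v j i • (Pi.single i (1 : ℝ) : σ → ℝ) := by
    funext j
    exact pi_eq_sum_univ' (v j)
  have h2 : T v = ∑ s : Fin k → σ, (∏ j, v j (s j)) • T (fun j => Pi.single (s j) 1) := by
    conv_lhs => rw [h1]
    rw [T.map_sum]
    refine Finset.sum_congr rfl fun s _ => ?_
    exact T.map_smul_univ (fun j => v j (s j)) (fun j => Pi.single (s j) 1)
  rw [h2]
  calc ‖∑ s : Fin k → σ, (∏ j, v j (s j)) • T (fun j => Pi.single (s j) 1)‖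
      ≤ ∑ s : Fin k → σ, (∏ j, ‖v j‖) * C := by
        refine norm_sum_le_of_le _ fun s _ => ?_
        rw [norm_smul, norm_prod]
        refine mul_le_mul (Finset.prod_le_prod (fun _ _ => norm_nonneg _)
          fun j _ => norm_le_pi_norm (v j) (s j)) (h s) (abs_nonneg _)
          (Finset.prod_nonneg fun _ _ => norm_nonneg _)
    _ = _ := by
        simp
        ring

theorem MemDC.dcAt (hM : IsDCSeq M) {V : Set (σ → ℝ)} (hV : IsOpen V) {f : (σ → ℝ) → ℝ}
    (hf : MemDC M V f) {x : σ → ℝ} (hx : x ∈ V) : DCAt M f x := by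
  obtain ⟨K, hK, hxK, hKV⟩ := exists_compact_subset hV hx
  obtain ⟨A, B, hA, hB, hb⟩ := hf.2 K hKV hK
  refine ⟨A, B * (Fintype.card σ + 1), hA, by positivity, ?_⟩
  filter_upwards [isOpen_interior.mem_nhds hxK] with y hy
  have hyK := interior_subset hy
  have hyV := hKV hyK
  refine ⟨hf.1.contDiffAt (hV.mem_nhds hyV), fun k => ?_⟩
  have hMk := hM.pos k
  have := norm_multilinear_le (iteratedFDeriv ℝ k f y)
    (C := A * B ^ k * k.factorial * M k) (by positivity) (fun s => by
      have hp : (List.ofFn s).Perm (mlist fun i => (List.ofFn s).count i) := by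
        rw [List.perm_iff_count]
        intro a
        rw [count_mlist]
      rw [← foldr_ofFn hV hf.1 k s y hyV, foldr_perm hV hf.1 hp y hyV, ← mpd_eq]
      have hdeg : mdeg (fun i => (List.ofFn s).count i) = k := by
        rw [← length_mlist, ← hp.length_eq, List.length_ofFn]
      refine (hb y hyK _).trans ?_
      have hfac : mfact (fun i => (List.ofFn s).count i) ≤ k.factorial := by
        conv_rhs => rw [← hdeg]
        exact Nat.le_of_dvd (Nat.factorial_pos _)
          (Nat.prod_factorial_dvd_factorial_sum _ _)
      rw [hdeg]
      gcongr)
  refine this.trans ?_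
  rw [mul_pow]
  calc (Fintype.card σ : ℝ) ^ k * (A * B ^ k * k.factorial * M k)
      ≤ ((Fintype.card σ : ℝ) + 1) ^ k * (A * B ^ k * k.factorial * M k) := by
        gcongr
        linarith
    _ = _ := by ring

theorem factorial_le_mfact (α : σ → ℕ) :
    (mdeg α).factorial ≤ Fintype.card σ ^ mdeg α * mfact α := by
  have h1 := Nat.multinomial_spec (univ : Finset σ) α
  have h2 : Nat.multinomial univ α ≤ Fintype.card σ ^ mdeg α := by
    have := Finset.sum_pow_eq_sum_piAntidiag (univ : Finset σ) (fun _ => (1 : ℕ)) (mdeg α)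
    simp only [one_pow, prod_const_one, mul_one, sum_const, card_univ, smul_eq_mul] at this
    simp only [Nat.cast_id] at this
    rw [this]
    exact Finset.single_le_sum (f := fun a => Nat.multinomial univ a) (fun _ _ => Nat.zero_le _)
      (by simp [mdeg])
  unfold mdeg mfact at *
  rw [← h1, mul_comm]
  gcongr

theorem mpd_le {V : Set (σ → ℝ)} (hV : IsOpen V) {f : (σ → ℝ) → ℝ}
    (hf : ContDiffOn ℝ (⊤ : ℕ∞) f V) {x : σ → ℝ} (hx : x ∈ V) (α : σ → ℕ) :
    |mpd α f x| ≤ ‖iteratedFDeriv ℝ (mdeg α) f x‖ := by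
  rw [mpd_eq, ← length_mlist]
  have := foldr_ofFn hV hf _ (mlist α).get x hx
  rw [List.ofFn_get] at this
  rw [this, ← Real.norm_eq_abs]
  refine (ContinuousMultilinearMap.le_opNorm _ _).trans ?_
  have : ∏ i, ‖(Pi.single ((mlist α).get i) (1 : ℝ) : σ → ℝ)‖ = 1 := by
    refine Finset.prod_eq_one fun i _ => ?_
    rw [Pi.norm_single]
    simp
  rw [this, mul_one]

theorem MemDC.of_dcAt (hM : IsDCSeq M) {V : Set (σ → ℝ)} (hV : IsOpen V) {f : (σ → ℝ) → ℝ}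
    (hf : ∀ x ∈ V, DCAt M f x) : MemDC M V f := by
  have hc : ContDiffOn ℝ (⊤ : ℕ∞) f V := fun x hx => (hf x hx).contDiffAt.contDiffWithinAt
  refine ⟨hc, fun K hKV hK => ?_⟩
  have key : ∃ A B : ℝ, 0 < A ∧ 0 < B ∧ ∀ x ∈ K, ∀ k,
      ‖iteratedFDeriv ℝ k f x‖ ≤ A * B ^ k * k.factorial * M k := by
    refine hK.induction_on (p := fun S => ∃ A B : ℝ, 0 < A ∧ 0 < B ∧ ∀ x ∈ S, ∀ k,
      ‖iteratedFDeriv ℝ k f x‖ ≤ A * B ^ k * k.factorial * M k) ?_ ?_ ?_ ?_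
    · exact ⟨1, 1, one_pos, one_pos, by simp⟩
    · rintro s t hst ⟨A, B, hA, hB, h⟩
      exact ⟨A, B, hA, hB, fun x hx => h x (hst hx)⟩
    · rintro s t ⟨A, B, hA, hB, h⟩ ⟨A', B', hA', hB', h'⟩
      refine ⟨max A A', max B B', lt_max_of_lt_left hA, lt_max_of_lt_left hB, ?_⟩
      rintro x (hx | hx) k
      · refine (h x hx k).trans ?_
        have := hM.pos k
        gcongr
        · exact le_max_left _ _
        · exact le_max_left _ _
      · refine (h' x hx k).trans ?_
        have := hM.pos k
        gcongr
        · exact le_max_right _ _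
        · exact le_max_right _ _
    · intro x hx
      obtain ⟨A, B, hA, hB, h⟩ := hf x (hKV hx)
      exact ⟨_, mem_nhdsWithin_of_mem_nhds h, A, B, hA, hB, fun y hy => hy.2⟩
  obtain ⟨A, B, hA, hB, h⟩ := key
  refine ⟨A, B * (Fintype.card σ + 1), hA, by positivity, fun x hx α => ?_⟩
  refine (mpd_le hV hc (hKV hx) α).trans ((h x hx _).trans ?_)
  have hMk := hM.pos (mdeg α)
  have h3 : ((mdeg α).factorial : ℝ) ≤ ((Fintype.card σ : ℝ) + 1) ^ mdeg α * mfact α := by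
    have : ((mdeg α).factorial : ℝ) ≤ (Fintype.card σ : ℝ) ^ mdeg α * mfact α := by
      exact_mod_cast factorial_le_mfact α
    refine this.trans ?_
    gcongr
    linarith
  calc A * B ^ mdeg α * (mdeg α).factorial * M (mdeg α)
      ≤ A * B ^ mdeg α * (((Fintype.card σ : ℝ) + 1) ^ mdeg α * mfact α) * M (mdeg α) := by
        gcongr
    _ = _ := by rw [mul_pow]; ring

end QDC

namespace QDC
open Filter Topology Finset

variable {n : ℕ} {M : ℕ → ℝ}

/-- coordinate projection -/
noncomputable def pr (I : Finset (Fin n)) : (Fin n → ℝ) →L[ℝ] ({ i : Fin n // i ∈ I } → ℝ) :=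
  ContinuousLinearMap.pi fun i => ContinuousLinearMap.proj i.1

theorem pr_apply (I : Finset (Fin n)) (y : Fin n → ℝ) (i : { i : Fin n // i ∈ I }) :
    pr I y i = y i := rfl

/-- near `b`, the set `X` is contained in the graph parametrized by `Ψ` over the coordinates `I`. -/
def Chart (M : ℕ → ℝ) (X : Set (Fin n → ℝ)) (I : Finset (Fin n)) (b : Fin n → ℝ)
    (Ψ : ({ i : Fin n // i ∈ I } → ℝ) → (Fin n → ℝ)) : Prop :=
  DCAt M Ψ (pr I b) ∧ Ψ (pr I b) = b ∧ (∀ᶠ u in 𝓝 (pr I b), pr I (Ψ u) = u) ∧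
    ∀ᶠ y in 𝓝 b, y ∈ X → y = Ψ (pr I y)

variable {X : Set (Fin n → ℝ)} {I : Finset (Fin n)} {b : Fin n → ℝ}
  {Ψ : ({ i : Fin n // i ∈ I } → ℝ) → (Fin n → ℝ)}

theorem tendsto_pr (I : Finset (Fin n)) (b : Fin n → ℝ) : Tendsto (pr I) (𝓝 b) (𝓝 (pr I b)) :=
  (pr I).continuous.continuousAt

theorem Chart.eventually (h : Chart M X I b Ψ) : ∀ᶠ y in 𝓝 b, y ∈ X → Chart M X I y Ψ := by
  obtain ⟨h1, h2, h3, h4⟩ := h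
  filter_upwards [(tendsto_pr I b).eventually h1.eventually,
    (tendsto_pr I b).eventually h3.eventually_nhds, h4.eventually_nhds] with y a1 a2 a3 hy
  exact ⟨a1, (a3.self_of_nhds hy).symm, a2, a3⟩

/-- insertion of a coordinate -/
noncomputable def ins (I : Finset (Fin n)) (j : Fin n) :
    ({ i : Fin n // i ∈ I.erase j } → ℝ) × ℝ →L[ℝ] ({ i : Fin n // i ∈ I } → ℝ) :=
  ContinuousLinearMap.pi fun i => if h : i.1 = j then ContinuousLinearMap.snd ℝ _ _ else
    (ContinuousLinearMap.proj (⟨i.1, Finset.mem_erase.2 ⟨h, i.2⟩⟩ : { i : Fin n // i ∈ I.erase j }))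
      ∘L ContinuousLinearMap.fst ℝ _ _

theorem ins_pr (I : Finset (Fin n)) (j : Fin n) (y : Fin n → ℝ) :
    ins I j (pr (I.erase j) y, y j) = pr I y := by
  funext i
  by_cases h : i.1 = j
  · simp [ins, h, pr_apply]
  · simp [ins, h, pr_apply]

theorem ins_ne (I : Finset (Fin n)) (j : Fin n) (u : { i : Fin n // i ∈ I.erase j } → ℝ) (t : ℝ)
    (i : { i : Fin n // i ∈ I.erase j }) :
    ins I j (u, t) ⟨i.1, Finset.mem_of_mem_erase i.2⟩ = u i := by
  have h : i.1 ≠ j := Finset.ne_of_mem_erase i.2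
  simp [ins, h]

theorem ins_single (I : Finset (Fin n)) (j : { i : Fin n // i ∈ I }) :
    ins I j.1 (0, 1) = Pi.single j 1 := by
  funext i
  by_cases h : i = j
  · subst h; simp [ins]
  · have : i.1 ≠ j.1 := fun h' => h (Subtype.ext h')
    simp [ins, h, this]

theorem Chart.reduce (hM : IsDCSeq M) (h : Chart M X I b Ψ) (j : { i : Fin n // i ∈ I })
    {G : ({ i : Fin n // i ∈ I } → ℝ) → ℝ} (hG : DCAt M G (pr I b)) (hG0 : G (pr I b) = 0)
    (hGX : ∀ᶠ y in 𝓝 b, y ∈ X → G (pr I y) = 0)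
    (hd : fderiv ℝ G (pr I b) (Pi.single j 1) ≠ 0) :
    ∃ Ψ', Chart M X (I.erase j.1) b Ψ' := by
  obtain ⟨h1, h2, h3, h4⟩ := h
  have hL : ins I j.1 (pr (I.erase j.1) b, b j.1) = pr I b := ins_pr I j.1 b
  have hG' : DCAt M G (ins I j.1 (pr (I.erase j.1) b, b j.1)) := by rw [hL]; exact hG
  obtain ⟨φ, p1, p2, p3⟩ := implicit hM (g := fun v => G (ins I j.1 v))
    (u := (pr (I.erase j.1) b, b j.1)) (DCAt.comp hM hG' (DCAt.clm hM _ _))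
    (by simp only [hL]; exact hG0) (by
      have := fderiv_comp (𝕜 := ℝ) (pr (I.erase j.1) b, b j.1)
        (hG'.contDiffAt.differentiableAt (by simp))
        (ins I j.1).differentiableAt
      change fderiv ℝ (G ∘ ins I j.1) _ _ ≠ 0
      rw [this, ContinuousLinearMap.fderiv, ContinuousLinearMap.comp_apply, ins_single, hL]
      exact hd)
  simp only at p1 p2 p3
  have hq : DCAt M (fun u => ins I j.1 (u, φ u)) (pr (I.erase j.1) b) :=
    (DCAt.prodMk hM (DCAt.clm hM (ContinuousLinearMap.id ℝ _) _) p1).clm_comp hM (ins I j.1)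
  have hq0 : ins I j.1 (pr (I.erase j.1) b, φ (pr (I.erase j.1) b)) = pr I b := by
    rw [p2, hL]
  refine ⟨fun u => Ψ (ins I j.1 (u, φ u)), DCAt.comp hM (by rw [hq0]; exact h1) hq,
    by simp only [hq0, h2], ?_, ?_⟩
  · have ht : Tendsto (fun u => ins I j.1 (u, φ u)) (𝓝 (pr (I.erase j.1) b)) (𝓝 (pr I b)) := by
      have := hq.continuousAt
      unfold ContinuousAt at this
      simpa only [hq0] using this
    filter_upwards [ht.eventually h3] with u hu
    funext i
    exact (congrFun hu ⟨i.1, Finset.mem_of_mem_erase i.2⟩).trans (ins_ne I j.1 u (φ u) i)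
  · have ht : Tendsto (fun y : Fin n → ℝ => (pr (I.erase j.1) y, y j.1)) (𝓝 b)
        (𝓝 (pr (I.erase j.1) b, b j.1)) := by
      apply Continuous.continuousAt (f := fun y : Fin n → ℝ => (pr (I.erase j.1) y, y j.1))
      fun_prop
    filter_upwards [ht.eventually p3, h4, hGX] with y a1 a2 a3 hy
    rw [ins_pr] at a1
    rw [← a1 (a3 hy), ins_pr]
    exact a2 hy

theorem Chart.smooth (hM : IsDCSeq M) (h : Chart M X I b Ψ)
    (hX : ∀ᶠ u in 𝓝 (pr I b), Ψ u ∈ X) : QMSmoothPt M X b := by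
  obtain ⟨h1, h2, h3, h4⟩ := h
  obtain ⟨Ω, hΩ, hΩo, hbΩ⟩ := eventually_nhds_iff.1 (h1.eventually.and (h3.and hX))
  obtain ⟨W, hW, hWo, hbW⟩ := eventually_nhds_iff.1
    (h4.and ((tendsto_pr I b).eventually (hΩo.mem_nhds hbΩ)))
  refine ⟨W, hWo, hbW, I, Ω, fun u j => Ψ u j.1, hΩo, fun j => ?_, ?_⟩
  · refine MemDC.of_dcAt hM hΩo fun u hu => ?_
    exact (hΩ u hu).1.clm_comp hM (ContinuousLinearMap.proj j.1)
  · ext y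
    constructor
    · rintro ⟨hyX, hyW⟩
      exact ⟨hyW, (hW y hyW).2, fun j => congrFun ((hW y hyW).1 hyX) j.1⟩
    · rintro ⟨hyW, hyΩ, hj⟩
      refine ⟨?_, hyW⟩
      have e : y = Ψ (pr I y) := by
        funext i
        by_cases hi : i ∈ I
        · exact (congrFun (hΩ _ hyΩ).2.1 ⟨i, hi⟩).symm
        · exact hj ⟨i, hi⟩
      rw [e]
      exact (hΩ _ hyΩ).2.2

theorem chart_univ (hM : IsDCSeq M) (X : Set (Fin n → ℝ)) (b : Fin n → ℝ) :
    ∃ Ψ, Chart M X univ b Ψ := by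
  let L : ({ i : Fin n // i ∈ (univ : Finset (Fin n)) } → ℝ) →L[ℝ] (Fin n → ℝ) :=
    ContinuousLinearMap.pi fun i => ContinuousLinearMap.proj ⟨i, mem_univ i⟩
  exact ⟨L, DCAt.clm hM L _, rfl, Eventually.of_forall fun u => rfl,
    Eventually.of_forall fun y _ => rfl⟩

theorem exists_single {ι : Type*} [Fintype ι] [DecidableEq ι] {T : (ι → ℝ) →L[ℝ] ℝ} (h : T ≠ 0) :
    ∃ j, T (Pi.single j 1) ≠ 0 := by
  by_contra! hc
  apply h
  ext w
  rw [pi_eq_sum_univ' w, map_sum]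
  simp [hc]

end QDC

namespace QDC
open Filter Topology Finset

/-- The set of `Q_M`-smooth points of a closed `Q_M`-subset `X` is dense in `X`. -/
theorem smooth_points_dense
    {n : ℕ} (M : ℕ → ℝ) (hM : IsDCSeq M)
    (U : Set (Fin n → ℝ)) (hU : IsOpen U)
    (X : Set (Fin n → ℝ)) (hX : IsQMClosed M U X) :
    X ⊆ closure {b ∈ X | QMSmoothPt M X b} := by
  classical
  intro b0 hb0
  rw [mem_closure_iff]
  intro O hO hb0O
  have hex : ∃ k, ∃ I : Finset (Fin n), ∃ b, ∃ Ψ, I.card = k ∧ b ∈ X ∧ b ∈ O ∧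
      Chart M X I b Ψ := by
    obtain ⟨Ψ, hΨ⟩ := chart_univ hM X b0
    exact ⟨_, univ, b0, Ψ, rfl, hb0, hb0O, hΨ⟩
  obtain ⟨I, b, Ψ, hcard, hbX, hbO, hch⟩ := Nat.find_spec hex
  have hmin : ∀ (j : { i : Fin n // i ∈ I }) (x : Fin n → ℝ), x ∈ X → x ∈ O →
      ¬ ∃ Ψ', Chart M X (I.erase j.1) x Ψ' := by
    rintro j x hx hxO ⟨Ψ', h'⟩
    refine Nat.find_min hex (m := (I.erase j.1).card) ?_ ⟨_, x, Ψ', rfl, hx, hxO, h'⟩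
    rw [← hcard]
    exact Finset.card_erase_lt_of_mem j.2
  obtain ⟨V, hVo, hbV, -, k, g, hg, hXV⟩ := hX.2.2 b hbX
  obtain ⟨W, hW, hWo, hbW⟩ := eventually_nhds_iff.1
    ((hO.eventually_mem hbO).and ((hVo.eventually_mem hbV).and hch.eventually))
  have hWO : ∀ x ∈ W, x ∈ O := fun x hx => (hW x hx).1
  have hWV : ∀ x ∈ W, x ∈ V := fun x hx => (hW x hx).2.1
  have hWC : ∀ x ∈ W, x ∈ X → Chart M X I x Ψ := fun x hx => (hW x hx).2.2
  let h : Fin k → ({ i : Fin n // i ∈ I } → ℝ) → ℝ := fun i u => g i (Ψ u)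
  have hdc : ∀ x ∈ W, x ∈ X → ∀ i, DCAt M (h i) (pr I x) := by
    intro x hx hxX i
    have hc := hWC x hx hxX
    refine DCAt.comp hM ?_ hc.1
    rw [hc.2.1]
    exact (hg i).dcAt hM hVo (hWV x hx)
  by_cases hA : ∃ x ∈ W, x ∈ X ∧ ∀ i m, iteratedFDeriv ℝ m (h i) (pr I x) = 0
  · obtain ⟨x, hxW, hxX, hfl⟩ := hA
    refine ⟨x, hWO x hxW, hxX, ?_⟩
    have hc := hWC x hxW hxX
    refine hc.smooth hM ?_
    have hz : ∀ᶠ u in 𝓝 (pr I x), ∀ i, h i u = 0 :=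
      eventually_all.2 fun i => quasi hM (hdc x hxW hxX i) (hfl i)
    have hv : ∀ᶠ u in 𝓝 (pr I x), Ψ u ∈ V := by
      refine hc.1.continuousAt.eventually_mem ?_
      rw [hc.2.1]
      exact hVo.mem_nhds (hWV x hxW)
    filter_upwards [hz, hv] with u hu1 hu2
    have : Ψ u ∈ X ∩ V := by
      rw [hXV]
      exact ⟨hu2, hu1⟩
    exact this.1
  · exfalso
    push Not at hA
    have hexm : ∃ m, ∃ x ∈ W, x ∈ X ∧ ∃ i, iteratedFDeriv ℝ m (h i) (pr I x) ≠ 0 := by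
      obtain ⟨i, m, hm⟩ := hA b hbW hbX
      exact ⟨m, b, hbW, hbX, i, hm⟩
    obtain ⟨x, hxW, hxX, i, hne⟩ := Nat.find_spec hexm
    have hlow := fun m (hm : m < Nat.find hexm) => Nat.find_min hexm hm
    generalize Nat.find hexm = m at hne hlow
    have hc := hWC x hxW hxX
    cases m with
    | zero =>
      apply hne
      ext v
      have : x ∈ X ∩ V := ⟨hxX, hWV x hxW⟩
      rw [hXV] at this
      simp only [iteratedFDeriv_zero_apply, h, hc.2.1]
      exact this.2 i
    | succ m =>
      have hvan : ∀ y ∈ W, y ∈ X → iteratedFDeriv ℝ m (h i) (pr I y) = 0 := by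
        intro y hy hyX
        by_contra hcon
        exact hlow m (Nat.lt_succ_self m) ⟨y, hy, hyX, i, hcon⟩
      have hv : ∃ v, iteratedFDeriv ℝ (m + 1) (h i) (pr I x) v ≠ 0 := by
        by_contra! hcon
        exact hne (ContinuousMultilinearMap.ext hcon)
      obtain ⟨v, hv⟩ := hv
      rw [iteratedFDeriv_succ_apply_left] at hv
      have hdd := (hdc x hxW hxX i).iteratedFDeriv hM m
      have hG : DCAt M (fun u => iteratedFDeriv ℝ m (h i) u (Fin.tail v)) (pr I x) :=
        hdd.clm_comp hM (ContinuousMultilinearMap.apply ℝ _ ℝ (Fin.tail v))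
      have hne2 : fderiv ℝ (fun u => iteratedFDeriv ℝ m (h i) u (Fin.tail v)) (pr I x) ≠ 0 := by
        intro h0
        apply hv
        have := fderiv_continuousMultilinear_apply_const_apply
          (hdd.contDiffAt.differentiableAt (by simp)) (Fin.tail v) (v 0)
        rw [h0] at this
        exact this.symm
      obtain ⟨j, hj⟩ := exists_single hne2
      refine hmin j x hxX (hWO x hxW) (hc.reduce hM j hG ?_ ?_ hj)
      · simp only [hvan x hxW hxX]
        rfl
      · filter_upwards [hWo.mem_nhds hxW] with y hy hyX
        simp only [hvan y hy hyX]
        rfl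

end QDC
end

section
/- (Borel's lemma with parameters.) Let 1 ≤ k ≤ n and identify ℝ^n = ℝ^k × ℝ^{n−k}. Let (F_α)_{α∈ℕ^n} be a family of functions F_α : ℝ^k → ℝ. Then there exists f ∈ C^∞(ℝ^n) such that F_α(a) = (∂^{|α|}f/∂x^α)(a,0)/α! for every a ∈ ℝ^k and every α ∈ ℕ^n, if and only if every F_α is continuously differentiable on ℝ^k and ∂F_α/∂ξ_i = (α_i+1)·F_{α+e_i} on ℝ^k for every α ∈ ℕ^n and every i = 1,…,k (where e_i ∈ ℕ^n is the i-th standard multi-index and ξ_1,…,ξ_k are the coordinates of ℝ^k). -/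
namespace QDC

open Filter Topology
open scoped ContDiff

section helpers

variable {σ : Type*} [Fintype σ] [DecidableEq σ]

lemma pd_smooth (i : σ) {f : (σ → ℝ) → ℝ} (hf : ContDiff ℝ ∞ f) : ContDiff ℝ ∞ (pd i f) := by
  have h := (contDiff_infty_iff_fderiv.1 hf).2
  exact h.clm_apply contDiff_const

lemma pd_iter_smooth (i : σ) (m : ℕ) {f : (σ → ℝ) → ℝ} (hf : ContDiff ℝ ∞ f) :
    ContDiff ℝ ∞ ((pd i)^[m] f) := by
  induction m with
  | zero => exact hf
  | succ m ih => rw [Function.iterate_succ_apply']; exact pd_smooth i ih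

lemma pd_comm (i j : σ) {f : (σ → ℝ) → ℝ} (hf : ContDiff ℝ ∞ f) :
    pd i (pd j f) = pd j (pd i f) := by
  have hd : Differentiable ℝ (fderiv ℝ f) :=
    (contDiff_infty_iff_fderiv.1 hf).2.differentiable (by simp)
  have key : ∀ (a b : σ) (x : σ → ℝ), pd a (pd b f) x
      = fderiv ℝ (fderiv ℝ f) x (Pi.single a 1) (Pi.single b 1) := by
    intro a b x
    unfold pd
    rw [fderiv_clm_apply (hd x) (differentiableAt_const _)]
    simp
  funext x
  rw [key, key]
  have hs : IsSymmSndFDerivAt ℝ f x :=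
    hf.contDiffAt.isSymmSndFDerivAt (by
      rw [minSmoothness_of_isRCLikeNormedField]
      exact WithTop.coe_le_coe.2 (le_top : (2 : ℕ∞) ≤ ⊤))
  exact hs.eq _ _

lemma pd_iter_comm (i j : σ) (m : ℕ) {f : (σ → ℝ) → ℝ} (hf : ContDiff ℝ ∞ f) :
    (pd j)^[m] (pd i f) = pd i ((pd j)^[m] f) := by
  induction m with
  | zero => rfl
  | succ m ih =>
    rw [Function.iterate_succ_apply', Function.iterate_succ_apply', ih,
      pd_comm j i (pd_iter_smooth j m hf)]

lemma foldr_smooth (l : List σ) (α : σ → ℕ) {f : (σ → ℝ) → ℝ} (hf : ContDiff ℝ ∞ f) :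
    ContDiff ℝ ∞ (l.foldr (fun i g => (pd i)^[α i] g) f) := by
  induction l with
  | nil => exact hf
  | cons a l ih => exact pd_iter_smooth a _ ih

lemma mpd_smooth (α : σ → ℕ) {f : (σ → ℝ) → ℝ} (hf : ContDiff ℝ ∞ f) :
    ContDiff ℝ ∞ (mpd α f) := foldr_smooth _ α hf

lemma foldr_notMem (l : List σ) (α : σ → ℕ) (i : σ) (hi : i ∉ l) (f : (σ → ℝ) → ℝ) :
    l.foldr (fun j g => (pd j)^[(α + Pi.single i 1 : σ → ℕ) j] g) f
      = l.foldr (fun j g => (pd j)^[α j] g) f := by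
  induction l with
  | nil => rfl
  | cons a l ih =>
    rw [List.mem_cons, not_or] at hi
    simp only [List.foldr_cons, ih hi.2]
    have : (Pi.single i 1 : σ → ℕ) a = 0 := Pi.single_eq_of_ne (Ne.symm hi.1) 1
    simp [this]

lemma foldr_mem (l : List σ) (hl : l.Nodup) (α : σ → ℕ) (i : σ) (hi : i ∈ l)
    {f : (σ → ℝ) → ℝ} (hf : ContDiff ℝ ∞ f) :
    l.foldr (fun j g => (pd j)^[(α + Pi.single i 1 : σ → ℕ) j] g) f
      = pd i (l.foldr (fun j g => (pd j)^[α j] g) f) := by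
  induction l with
  | nil => simp at hi
  | cons a l ih =>
    rw [List.nodup_cons] at hl
    by_cases ha : a = i
    · subst ha
      simp only [List.foldr_cons, foldr_notMem l α a hl.1 f]
      have : (α + Pi.single a 1 : σ → ℕ) a = α a + 1 := by simp
      rw [this, Function.iterate_succ_apply']
    · have hi' : i ∈ l := by
        rcases List.mem_cons.1 hi with h | h
        · exact absurd h.symm ha
        · exact h
      simp only [List.foldr_cons, ih hl.2 hi']
      have : (α + Pi.single i 1 : σ → ℕ) a = α a := by simp [Pi.single_eq_of_ne ha]
      rw [this, pd_iter_comm i a _ (foldr_smooth l α hf)]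

lemma mpd_add_single (α : σ → ℕ) (i : σ) {f : (σ → ℝ) → ℝ} (hf : ContDiff ℝ ∞ f) :
    mpd (α + Pi.single i 1) f = pd i (mpd α f) :=
  foldr_mem _ (Finset.nodup_toList _) α i (by simp) hf

lemma mpd_zero (f : (σ → ℝ) → ℝ) : mpd (0 : σ → ℕ) f = f := by
  unfold mpd
  induction (Finset.univ : Finset σ).toList with
  | nil => rfl
  | cons a l ih => simp

lemma mfact_add_single (α : σ → ℕ) (i : σ) :
    mfact (α + Pi.single i 1) = (α i + 1) * mfact α := by
  unfold mfact
  rw [← Finset.mul_prod_erase _ _ (Finset.mem_univ i),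
    ← Finset.mul_prod_erase _ (fun j => (α j).factorial) (Finset.mem_univ i), ← mul_assoc]
  congr 1
  · simp [Nat.factorial_succ]
  · refine Finset.prod_congr rfl fun j hj => ?_
    simp [Pi.single_eq_of_ne (Finset.ne_of_mem_erase hj)]

lemma mi_induction {P : (σ → ℕ) → Prop} (h0 : P 0)
    (hs : ∀ α i, P α → P (α + Pi.single i 1)) (α : σ → ℕ) : P α := by
  induction hm : ∑ i, α i generalizing α with
  | zero =>
    have : α = 0 := by
      funext i
      exact (Finset.sum_eq_zero_iff.1 hm) i (Finset.mem_univ i)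
    rw [this]; exact h0
  | succ m ih =>
    obtain ⟨i, -, hi⟩ : ∃ i ∈ Finset.univ, α i ≠ 0 :=
      Finset.exists_ne_zero_of_sum_ne_zero (by rw [hm]; omega)
    have he : α = (α - Pi.single i 1) + Pi.single i 1 := by
      funext j
      by_cases hj : j = i
      · subst hj; simp; omega
      · simp [Pi.single_eq_of_ne hj]
    rw [he]
    apply hs
    apply ih
    rw [he] at hm
    simp only [Pi.add_apply, Finset.sum_add_distrib, Finset.sum_pi_single', Finset.mem_univ, if_true] at hm
    have h1 : ∑ j, (Pi.single i 1 : σ → ℕ) j = 1 := by simp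
    omega

lemma mpd_eq_iter (α : σ → ℕ) : ∃ (N : ℕ) (v : Fin N → (σ → ℝ)),
    ∀ f : (σ → ℝ) → ℝ, ContDiff ℝ ∞ f → ∀ x, mpd α f x = iteratedFDeriv ℝ N f x v := by
  induction α using mi_induction with
  | h0 => exact ⟨0, ![], fun f _ x => by simp [mpd_zero]⟩
  | hs α i ih =>
    obtain ⟨N, v, h⟩ := ih
    refine ⟨N + 1, Fin.cons (Pi.single i 1) v, fun f hf x => ?_⟩
    rw [mpd_add_single α i hf, iteratedFDeriv_succ_apply_left]
    have : mpd α f = fun x => iteratedFDeriv ℝ N f x v := funext (h f hf)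
    rw [this]
    have hd : DifferentiableAt ℝ (iteratedFDeriv ℝ N f) x :=
      (hf.differentiable_iteratedFDeriv (m := N) (by exact_mod_cast ENat.natCast_lt_top N)) x
    have := (ContinuousMultilinearMap.apply ℝ (fun _ : Fin N => (σ → ℝ)) ℝ v).hasFDerivAt.comp x
      hd.hasFDerivAt
    unfold pd
    have h2 := this.fderiv
    simp only [Function.comp_def, ContinuousMultilinearMap.apply_apply] at h2
    rw [h2]
    simp

lemma mpd_congr_nhds (α : σ → ℕ) {f g : (σ → ℝ) → ℝ} (hf : ContDiff ℝ ∞ f)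
    (hg : ContDiff ℝ ∞ g) {x : σ → ℝ} (h : f =ᶠ[𝓝 x] g) : mpd α f x = mpd α g x := by
  obtain ⟨N, v, hv⟩ := mpd_eq_iter α
  rw [hv f hf, hv g hg, (h.iteratedFDeriv ℝ N).eq_of_nhds]

end helpers

section bounds

variable {E G : Type*} [NormedAddCommGroup E] [NormedSpace ℝ E]
  [NormedAddCommGroup G] [NormedSpace ℝ G]

/-- all derivatives are bounded -/
def BD (f : E → ℝ) : Prop :=
  ContDiff ℝ ∞ f ∧ ∀ j : ℕ, ∃ C : ℝ, 0 ≤ C ∧ ∀ x, ‖iteratedFDeriv ℝ j f x‖ ≤ C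

lemma BD.of_compact {f : E → ℝ} (hf : ContDiff ℝ ∞ f) (hc : HasCompactSupport f) : BD f := by
  refine ⟨hf, fun j => ?_⟩
  obtain ⟨C, hC⟩ := (hc.iteratedFDeriv (𝕜 := ℝ) j).exists_bound_of_continuous
    (hf.continuous_iteratedFDeriv (m := j) (by exact_mod_cast le_top))
  exact ⟨C, (norm_nonneg _).trans (hC 0), hC⟩

lemma norm_comp_clm_le {f : E → ℝ} (hf : ContDiff ℝ ∞ f) (L : G →L[ℝ] E) (j : ℕ) {C : ℝ}
    (hC : ∀ x, ‖iteratedFDeriv ℝ j f x‖ ≤ C) (x : G) :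
    ‖iteratedFDeriv ℝ j (fun y => f (L y)) x‖ ≤ C * ‖L‖ ^ j := by
  have := L.iteratedFDeriv_comp_right hf x (i := j) (by exact_mod_cast le_top)
  simp only [Function.comp_def] at this
  rw [this]
  refine (ContinuousMultilinearMap.norm_compContinuousLinearMap_le _ _).trans ?_
  simp only [Finset.prod_const, Finset.card_univ, Fintype.card_fin]
  gcongr
  exact hC _

lemma BD.comp_clm {f : E → ℝ} (hf : BD f) (L : G →L[ℝ] E) : BD (fun y => f (L y)) := by
  refine ⟨hf.1.comp L.contDiff, fun j => ?_⟩
  obtain ⟨C, h0, hC⟩ := hf.2 j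
  exact ⟨C * ‖L‖ ^ j, by positivity, norm_comp_clm_le hf.1 L j hC⟩

lemma BD.mul {f g : E → ℝ} (hf : BD f) (hg : BD g) : BD (fun y => f y * g y) := by
  refine ⟨hf.1.mul hg.1, fun j => ?_⟩
  choose A hA0 hA using hf.2
  choose B hB0 hB using hg.2
  refine ⟨∑ i ∈ Finset.range (j + 1), (j.choose i : ℝ) * A i * B (j - i),
    Finset.sum_nonneg fun i _ => mul_nonneg (mul_nonneg (by positivity) (hA0 _)) (hB0 _),
    fun x => ?_⟩
  refine (norm_iteratedFDeriv_mul_le hf.1 hg.1 x (n := j) (by exact_mod_cast le_top)).trans ?_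
  gcongr with i hi
  · exact mul_nonneg (by positivity) (hA0 _)
  · exact hA i x
  · exact hB _ x

lemma BD.const_mul {f : E → ℝ} (hf : BD f) (c : ℝ) : BD (fun y => c * f y) := by
  refine ⟨contDiff_const.mul hf.1, fun j => ?_⟩
  obtain ⟨C, h0, hC⟩ := hf.2 j
  refine ⟨|c| * C, by positivity, fun x => ?_⟩
  have := iteratedFDeriv_const_smul_apply (𝕜 := ℝ) (i := j) (a := c) (f := f) (x := x)
    (hf.1.contDiffAt.of_le (by exact_mod_cast le_top))
  have h2 : (fun y => c * f y) = c • f := rfl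
  rw [h2, this, norm_smul, Real.norm_eq_abs]
  gcongr
  exact hC x

lemma scaled_small {A : E → ℝ} (hA : BD A) {P : G → ℝ} (hP : BD P) (Q : E →L[ℝ] G) (m j : ℕ)
    (hj : j < m) {δ : ℝ} (hδ : 0 < δ) :
    ∀ᶠ c : ℝ in atTop, ∀ x,
      ‖iteratedFDeriv ℝ j (fun y => A y * ((c ^ m)⁻¹ * P (c • Q y))) x‖ ≤ δ := by
  choose a ha0 ha using hA.2
  choose b hb0 hb using hP.2
  set C : ℝ := ∑ i ∈ Finset.range (j + 1), (j.choose i : ℝ) * a i * (b (j - i) * ‖Q‖ ^ (j - i))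
    with hCdef
  have hC0 : 0 ≤ C := Finset.sum_nonneg fun i _ =>
    mul_nonneg (mul_nonneg (by positivity) (ha0 _)) (mul_nonneg (hb0 _) (by positivity))
  filter_upwards [eventually_ge_atTop (1 : ℝ), eventually_ge_atTop (C / δ)] with c hc1 hc2 x
  have hc0 : 0 < c := by linarith
  have hPc : ∀ i ≤ j, ∀ x, ‖iteratedFDeriv ℝ i (fun y => (c ^ m)⁻¹ * P (c • Q y)) x‖
      ≤ c⁻¹ * (b i * ‖Q‖ ^ i) := by
    intro i hi x
    have hs : ContDiff ℝ ∞ (fun y => P ((c • Q) y)) := hP.1.comp (c • Q).contDiff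
    have := iteratedFDeriv_const_smul_apply (𝕜 := ℝ) (i := i) (a := (c ^ m)⁻¹)
      (f := fun y => P ((c • Q) y)) (x := x)
      (hs.contDiffAt.of_le (by exact_mod_cast le_top))
    have h2 : (fun y => (c ^ m)⁻¹ * P (c • Q y)) = (c ^ m)⁻¹ • (fun y => P ((c • Q) y)) := rfl
    rw [h2, this, norm_smul, Real.norm_eq_abs, abs_of_pos (by positivity)]
    have h3 := norm_comp_clm_le hP.1 (c • Q) i (hb i) x
    rw [norm_smul, Real.norm_eq_abs, abs_of_pos hc0, mul_pow] at h3
    have h4 : c * c ^ i ≤ c ^ m := by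
      rw [← pow_succ']
      exact pow_le_pow_right₀ hc1 (by omega)
    have h5 : (c ^ m)⁻¹ * c ^ i ≤ c⁻¹ := by
      rw [inv_mul_le_iff₀ (by positivity), ← div_eq_mul_inv, le_div_iff₀ hc0, mul_comm]
      exact h4
    calc _ ≤ (c ^ m)⁻¹ * (b i * (c ^ i * ‖Q‖ ^ i)) := by gcongr
      _ = ((c ^ m)⁻¹ * c ^ i) * (b i * ‖Q‖ ^ i) := by ring
      _ ≤ _ := by
        have := hb0 i
        gcongr
  have hs : ContDiff ℝ ∞ (fun y => (c ^ m)⁻¹ * P (c • Q y)) :=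
    contDiff_const.mul (hP.1.comp (c • Q).contDiff)
  refine (norm_iteratedFDeriv_mul_le hA.1 hs x (n := j) (by exact_mod_cast le_top)).trans ?_
  calc _ ≤ ∑ i ∈ Finset.range (j + 1),
        (j.choose i : ℝ) * a i * (c⁻¹ * (b (j - i) * ‖Q‖ ^ (j - i))) := by
        gcongr with i hi
        · exact mul_nonneg (by positivity) (ha0 _)
        · exact ha i x
        · exact hPc _ (by omega) x
    _ = c⁻¹ * C := by
        rw [hCdef, Finset.mul_sum]
        exact Finset.sum_congr rfl fun i _ => by ring
    _ ≤ δ := by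
        rw [inv_mul_le_iff₀ hc0]
        rw [div_le_iff₀ hδ] at hc2
        exact hc2

end bounds

set_option linter.unusedSectionVars false

section series

variable {σ : Type*} [Fintype σ] [DecidableEq σ]

lemma series_lemma {ι : Type*} {S : ι → (σ → ℝ) → ℝ} (hS : ∀ i, BD (S i)) {u : ι → ℝ}
    (hu : Summable u)
    (hb : ∀ j : ℕ, ∀ᶠ i in cofinite, ∀ x, ‖iteratedFDeriv ℝ j (S i) x‖ ≤ u i) :
    ContDiff ℝ ∞ (fun x => ∑' i, S i x) ∧
    ∀ α x, mpd α (fun x => ∑' i, S i x) x = ∑' i, mpd α (S i) x := by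
  classical
  choose C hC0 hC using fun i => (hS i).2
  set v : ℕ → ι → ℝ := fun j i =>
    if ∀ x, ‖iteratedFDeriv ℝ j (S i) x‖ ≤ u i then u i else C i j with hv
  have hvs : ∀ j : ℕ, (j : ℕ∞) ≤ ⊤ → Summable (v j) := by
    intro j _
    refine (summable_congr_cofinite ?_).1 hu
    filter_upwards [hb j] with i hi
    simp only [hv]
    rw [if_pos hi]
  have hvb : ∀ (j : ℕ) (i : ι) (x : σ → ℝ), (j : ℕ∞) ≤ ⊤ →
      ‖iteratedFDeriv ℝ j (S i) x‖ ≤ v j i := by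
    intro j i x _
    simp only [hv]
    split_ifs with h
    · exact h x
    · exact hC i j x
  have hsm : ContDiff ℝ ∞ (fun x => ∑' i, S i x) :=
    contDiff_tsum (N := ⊤) (fun i => (hS i).1) hvs hvb
  refine ⟨hsm, fun α x => ?_⟩
  obtain ⟨N, w, hw⟩ := mpd_eq_iter α
  rw [hw _ hsm, iteratedFDeriv_tsum_apply (N := ⊤) (fun i => (hS i).1) hvs hvb le_top x]
  have hsum : Summable fun i => iteratedFDeriv ℝ N (S i) x :=
    Summable.of_norm_bounded (hvs N le_top) fun i => hvb N i x le_top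
  have := (ContinuousMultilinearMap.apply ℝ (fun _ : Fin N => (σ → ℝ)) ℝ w).map_tsum hsum
  simp only [ContinuousMultilinearMap.apply_apply] at this
  rw [this]
  exact tsum_congr fun i => (hw _ (hS i).1 x).symm

lemma pd_eq_deriv (j : σ) {f : (σ → ℝ) → ℝ} (hf : ContDiff ℝ ∞ f) (x : σ → ℝ) :
    pd j f x = deriv (fun t : ℝ => f (x + t • Pi.single j 1)) 0 := by
  have := ((hf.differentiable (by simp)) x).lineDeriv_eq_fderiv (v := Pi.single j 1)
  unfold pd
  rw [← this]
  rfl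

/-- monomials -/
def mono (γ : σ → ℕ) (x : σ → ℝ) : ℝ := ∏ i, x i ^ γ i

lemma mono_smooth (γ : σ → ℕ) : ContDiff ℝ ∞ (mono γ) := by
  unfold mono
  exact contDiff_prod fun i _ => (contDiff_apply ℝ ℝ i).pow _

end series

section geometry

variable {n k : ℕ} (hkn : k ≤ n)

/-- inclusion of the parameter space -/
noncomputable def incl (n k : ℕ) : (Fin k → ℝ) →L[ℝ] (Fin n → ℝ) :=
  ContinuousLinearMap.pi fun i => if h : (i : ℕ) < k then ContinuousLinearMap.proj ⟨i, h⟩ else 0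

lemma incl_apply (a : Fin k → ℝ) :
    incl n k a = fun i : Fin n => if h : (i : ℕ) < k then a ⟨i, h⟩ else 0 := by
  funext i
  simp only [incl, ContinuousLinearMap.coe_pi']
  split_ifs <;> simp

/-- projection to the parameter space -/
noncomputable def projL : (Fin n → ℝ) →L[ℝ] (Fin k → ℝ) :=
  ContinuousLinearMap.pi fun i => ContinuousLinearMap.proj (Fin.castLE hkn i)

lemma projL_apply (x : Fin n → ℝ) (i : Fin k) : projL hkn x i = x (Fin.castLE hkn i) := rfl

/-- projection to the complement -/
noncomputable def projQ (n k : ℕ) : (Fin n → ℝ) →L[ℝ] (Fin n → ℝ) :=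
  ContinuousLinearMap.pi fun i => if (i : ℕ) < k then 0 else ContinuousLinearMap.proj i

lemma projQ_apply (x : Fin n → ℝ) (i : Fin n) :
    projQ n k x i = if (i : ℕ) < k then 0 else x i := by
  simp only [projQ, ContinuousLinearMap.coe_pi']
  split_ifs <;> simp

lemma projL_incl (a : Fin k → ℝ) : projL hkn (incl n k a) = a := by
  funext i
  simp [projL_apply, incl_apply]

lemma projQ_incl (a : Fin k → ℝ) : projQ n k (incl n k a) = 0 := by
  funext i
  rw [projQ_apply, incl_apply]
  simp only [Pi.zero_apply]
  split_ifs <;> rfl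

lemma incl_single (i : Fin k) :
    incl n k (Pi.single i 1) = Pi.single (Fin.castLE hkn i) 1 := by
  rw [incl_apply]
  funext j
  by_cases h : j = Fin.castLE hkn i
  · subst h; simp
  · rw [Pi.single_eq_of_ne h]
    split_ifs with h2
    · rw [Pi.single_eq_of_ne]
      intro h3
      apply h
      ext
      simp [← h3]
    · rfl

lemma projL_single (j : Fin n) (hj : k ≤ (j : ℕ)) : projL hkn (Pi.single j 1) = 0 := by
  funext i
  rw [projL_apply, Pi.single_eq_of_ne]
  · rfl
  · intro h
    have := i.2
    have h2 : (i : ℕ) = j := by rw [← h]; rfl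
    omega

lemma pd_comp_incl (i : Fin k) {g : (Fin n → ℝ) → ℝ} (hg : ContDiff ℝ ∞ g) (a : Fin k → ℝ) :
    pd i (fun a => g (incl n k a)) a = pd (Fin.castLE hkn i) g (incl n k a) := by
  have h1 := ((hg.differentiable (by simp)) (incl n k a)).hasFDerivAt.comp a
    (incl n k).hasFDerivAt
  have h2 := h1.fderiv
  simp only [Function.comp_def] at h2
  unfold pd
  rw [h2]
  simp [incl_single hkn]

lemma family_smooth {F : (Fin n → ℕ) → (Fin k → ℝ) → ℝ}
    (h1 : ∀ α, ContDiff ℝ 1 (F α))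
    (h2 : ∀ (α : Fin n → ℕ) (i : Fin k), pd i (F α) =
      fun a => ((α (Fin.castLE hkn i) + 1 : ℕ) : ℝ) * F (α + Pi.single (Fin.castLE hkn i) 1) a)
    (α : Fin n → ℕ) : ContDiff ℝ ∞ (F α) := by
  rw [contDiff_infty]
  intro m
  induction m generalizing α with
  | zero => exact (h1 α).of_le (by simp)
  | succ m ih =>
    have : ((m + 1 : ℕ) : ℕ∞ω) = (m : ℕ∞ω) + 1 := by push_cast; rfl
    rw [this, contDiff_succ_iff_fderiv_apply]
    refine ⟨(h1 α).differentiable (by simp), fun h => by simp at h, fun y => ?_⟩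
    have hy : (fun x => fderiv ℝ (F α) x y) = fun x => ∑ i, y i * pd i (F α) x := by
      funext x
      conv_lhs => rw [pi_eq_sum_univ' y]
      rw [map_sum]
      refine Finset.sum_congr rfl fun i _ => ?_
      rw [map_smul, smul_eq_mul]
      unfold pd
      congr 2
    rw [hy]
    refine ContDiff.sum fun i _ => contDiff_const.mul ?_
    rw [h2]
    exact contDiff_const.mul (ih _)

lemma cmono_smooth {c : (Fin k → ℝ) → ℝ} (hc : ContDiff ℝ ∞ c) (γ : Fin n → ℕ) :
    ContDiff ℝ ∞ (fun x => c (projL hkn x) * mono γ x) :=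
  (hc.comp (projL hkn).contDiff).mul (mono_smooth γ)

lemma pd_mono {c : (Fin k → ℝ) → ℝ} (hc : ContDiff ℝ ∞ c) (γ : Fin n → ℕ) (j : Fin n)
    (hj : k ≤ (j : ℕ)) :
    pd j (fun x => c (projL hkn x) * mono γ x) =
      fun x => (γ j : ℝ) * c (projL hkn x) * mono (γ - Pi.single j 1) x := by
  funext x
  rw [pd_eq_deriv j (cmono_smooth hkn hc γ)]
  have hL : ∀ t : ℝ, projL hkn (x + t • Pi.single j 1) = projL hkn x := by
    intro t; rw [map_add, map_smul, projL_single hkn j hj]; simp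
  have hm : ∀ t : ℝ, mono γ (x + t • Pi.single j 1)
      = (x j + t) ^ γ j * ∏ i ∈ Finset.univ.erase j, x i ^ γ i := by
    intro t
    unfold mono
    rw [← Finset.mul_prod_erase _ _ (Finset.mem_univ j)]
    congr 1
    · simp
    · refine Finset.prod_congr rfl fun i hi => ?_
      simp [Pi.single_eq_of_ne (Finset.ne_of_mem_erase hi)]
  have hm2 : mono (γ - Pi.single j 1) x
      = x j ^ (γ j - 1) * ∏ i ∈ Finset.univ.erase j, x i ^ γ i := by
    unfold mono
    rw [← Finset.mul_prod_erase _ _ (Finset.mem_univ j)]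
    congr 1
    · simp
    · refine Finset.prod_congr rfl fun i hi => ?_
      simp [Pi.single_eq_of_ne (Finset.ne_of_mem_erase hi)]
  simp only [hL, hm, hm2]
  have hd : HasDerivAt (fun t : ℝ => (x j + t) ^ γ j) ((γ j : ℝ) * x j ^ (γ j - 1)) 0 := by
    have := ((hasDerivAt_id (0 : ℝ)).const_add (x j)).pow (γ j)
    simp only [id, add_zero, mul_one] at this
    exact this
  rw [((hd.mul_const _).const_mul _).deriv]
  ring

lemma mpd_mono {c : (Fin k → ℝ) → ℝ} (hc : ContDiff ℝ ∞ c) (γ δ : Fin n → ℕ)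
    (hδ : ∀ i : Fin n, (i : ℕ) < k → δ i = 0) :
    mpd δ (fun x => c (projL hkn x) * mono γ x) =
      fun x => ((∏ i, (γ i).descFactorial (δ i) : ℕ) : ℝ) * c (projL hkn x) * mono (γ - δ) x := by
  induction δ using mi_induction with
  | h0 => simp [mpd_zero]
  | hs δ j ih =>
    have hj : k ≤ (j : ℕ) := by
      by_contra h
      have := hδ j (by omega)
      simp at this
    have hδ' : ∀ i : Fin n, (i : ℕ) < k → δ i = 0 := by
      intro i hi
      have := hδ i hi
      simp at this
      exact this.1
    rw [mpd_add_single _ _ (cmono_smooth hkn hc γ), ih hδ',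
      pd_mono hkn (c := fun a => ((∏ i, (γ i).descFactorial (δ i) : ℕ) : ℝ) * c a)
        (contDiff_const.mul hc) _ j hj]
    have hD : ∏ i, (γ i).descFactorial ((δ + Pi.single j 1 : Fin n → ℕ) i)
        = (γ j - δ j) * ∏ i, (γ i).descFactorial (δ i) := by
      rw [← Finset.mul_prod_erase _ _ (Finset.mem_univ j),
        ← Finset.mul_prod_erase _ (fun i => (γ i).descFactorial (δ i)) (Finset.mem_univ j),
        ← mul_assoc]
      congr 1
      · simp [Nat.descFactorial_succ]
      · refine Finset.prod_congr rfl fun i hi => ?_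
        simp [Pi.single_eq_of_ne (Finset.ne_of_mem_erase hi)]
    funext x
    rw [hD, ← tsub_tsub]
    simp only [Pi.sub_apply, Nat.cast_mul]
    ring

lemma mpd_mono_incl {c : (Fin k → ℝ) → ℝ} (hc : ContDiff ℝ ∞ c) (γ δ : Fin n → ℕ)
    (hδ : ∀ i : Fin n, (i : ℕ) < k → δ i = 0) (hγ : ∀ i : Fin n, (i : ℕ) < k → γ i = 0)
    (a : Fin k → ℝ) :
    mpd δ (fun x => c (projL hkn x) * mono γ x) (incl n k a) =
      if γ = δ then (mfact δ : ℝ) * c a else 0 := by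
  rw [mpd_mono hkn hc γ δ hδ]
  simp only [projL_incl]
  split_ifs with h
  · subst h
    simp [mono, mfact, Nat.descFactorial_self]
  · obtain ⟨i, hi⟩ := Function.ne_iff.1 h
    rcases lt_or_gt_of_ne hi with h1 | h1
    · have : ∏ i, (γ i).descFactorial (δ i) = 0 :=
        Finset.prod_eq_zero (Finset.mem_univ i) (Nat.descFactorial_of_lt h1)
      rw [this]; simp
    · have hik : ¬ (i : ℕ) < k := fun h2 => by
        have := hγ i h2
        omega
      have : mono (γ - δ) (incl n k a) = 0 := by
        unfold mono
        refine Finset.prod_eq_zero (Finset.mem_univ i) ?_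
        rw [incl_apply]
        simp only [hik, dite_false, Pi.sub_apply]
        exact zero_pow (by omega)
      rw [this, mul_zero]

end geometry

section main

variable {n k : ℕ}

lemma mono_scale {γ : Fin n → ℕ} (hγ : ∀ i : Fin n, (i : ℕ) < k → γ i = 0) (c : ℝ)
    (x : Fin n → ℝ) : mono γ (c • projQ n k x) = c ^ (∑ i, γ i) * mono γ x := by
  unfold mono
  rw [← Finset.prod_pow_eq_pow_sum, ← Finset.prod_mul_distrib]
  refine Finset.prod_congr rfl fun i _ => ?_
  by_cases h : (i : ℕ) < k
  · simp [hγ i h]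
  · simp [projQ_apply, h, mul_pow]

lemma finite_deg_le (m : ℕ) : {γ : Fin n → ℕ | ∑ i, γ i ≤ m}.Finite := by
  refine (Set.finite_Iic (fun _ : Fin n => m)).subset fun γ hγ i => ?_
  exact (Finset.single_le_sum (f := γ) (fun _ _ => Nat.zero_le _) (Finset.mem_univ i)).trans hγ

/-- cutoff on the parameter space -/
noncomputable def cut (k R : ℕ) : ContDiffBump (0 : Fin k → ℝ) :=
  ⟨R + 1, R + 2, by positivity, by linarith⟩

/-- cutoff on the big space -/
noncomputable def bmp (n : ℕ) : ContDiffBump (0 : Fin n → ℝ) :=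
  ⟨1, 2, by norm_num, by norm_num⟩

lemma exists_transverse (hkn : k ≤ n) (G : (Fin n → ℕ) → (Fin k → ℝ) → ℝ) (hG : ∀ γ, ContDiff ℝ ∞ (G γ))
    (hG0 : ∀ γ : Fin n → ℕ, ¬ (∀ i : Fin n, (i : ℕ) < k → γ i = 0) → G γ = 0) :
    ∃ f : (Fin n → ℝ) → ℝ, ContDiff ℝ ∞ f ∧
      ∀ δ : Fin n → ℕ, (∀ i : Fin n, (i : ℕ) < k → δ i = 0) → ∀ a,
        mpd δ f (incl n k a) = (mfact δ : ℝ) * G δ a := by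
  classical
  have : Encodable (Fin n → ℕ) := Encodable.ofCountable _
  set P : (Fin n → ℕ) → (Fin n → ℝ) → ℝ := fun γ y => mono γ y * bmp n y with hPdef
  have hP : ∀ γ, BD (P γ) := fun γ =>
    BD.of_compact ((mono_smooth γ).mul (bmp n).contDiff) (bmp n).hasCompactSupport.mul_left
  set A : ℕ → (Fin n → ℕ) → (Fin n → ℝ) → ℝ :=
    fun R γ x => cut k R (projL hkn x) * G γ (projL hkn x) with hAdef
  have hA : ∀ R γ, BD (A R γ) := by
    intro R γ
    have : BD (fun u => cut k R u * G γ u) :=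
      BD.of_compact ((cut k R).contDiff.mul (hG γ)) (cut k R).hasCompactSupport.mul_right
    exact this.comp_clm (projL hkn)
  have hex : ∀ γ : Fin n → ℕ, ∃ c : ℝ, 1 ≤ c ∧ ∀ R ≤ Encodable.encode γ, ∀ j < ∑ i, γ i, ∀ x,
      ‖iteratedFDeriv ℝ j
        (fun y => A R γ y * ((c ^ (∑ i, γ i))⁻¹ * P γ (c • projQ n k y))) x‖
        ≤ (1 / 2 : ℝ) ^ Encodable.encode γ := by
    intro γ
    have h : ∀ᶠ c : ℝ in atTop, 1 ≤ c ∧ ∀ R ∈ Set.Iic (Encodable.encode γ),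
        ∀ j ∈ Set.Iio (∑ i, γ i), ∀ x, ‖iteratedFDeriv ℝ j
        (fun y => A R γ y * ((c ^ (∑ i, γ i))⁻¹ * P γ (c • projQ n k y))) x‖
        ≤ (1 / 2 : ℝ) ^ Encodable.encode γ := by
      refine (eventually_ge_atTop 1).and ?_
      rw [eventually_all_finite (Set.finite_Iic _)]
      intro R _
      rw [eventually_all_finite (Set.finite_Iio _)]
      intro j hj
      exact scaled_small (hA R γ) (hP γ) (projQ n k) _ j hj (by positivity)
    obtain ⟨c, h1, h2⟩ := h.exists
    exact ⟨c, h1, fun R hR j hj => h2 R hR j hj⟩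
  choose c hc1 hc using hex
  set T : (Fin n → ℕ) → (Fin n → ℝ) → ℝ :=
    fun γ y => (c γ ^ (∑ i, γ i))⁻¹ * P γ (c γ • projQ n k y) with hTdef
  have hT : ∀ γ, BD (T γ) := fun γ => ((hP γ).comp_clm (c γ • projQ n k)).const_mul _
  set S : ℕ → (Fin n → ℕ) → (Fin n → ℝ) → ℝ := fun R γ y => A R γ y * T γ y with hSdef
  have hser : ∀ R, ContDiff ℝ ∞ (fun x => ∑' γ, S R γ x) ∧
      ∀ α x, mpd α (fun x => ∑' γ, S R γ x) x = ∑' γ, mpd α (S R γ) x := by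
    intro R
    refine series_lemma (fun γ => (hA R γ).mul (hT γ)) summable_geometric_two_encode ?_
    intro j
    have h1 : ∀ᶠ γ : Fin n → ℕ in cofinite, ¬ (∑ i, γ i ≤ j) :=
      (finite_deg_le j).eventually_cofinite_notMem
    have h2 : ∀ᶠ γ : Fin n → ℕ in cofinite, ¬ (Encodable.encode γ ≤ R) :=
      ((Set.finite_Iic R).preimage Encodable.encode_injective.injOn).eventually_cofinite_notMem
    filter_upwards [h1, h2] with γ h1 h2
    exact hc γ R (by omega) j (by omega)
  set f : (Fin n → ℝ) → ℝ := fun x => ∑' γ, G γ (projL hkn x) * T γ x with hfdef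
  have hcut : ∀ (R : ℕ) (x : Fin n → ℝ), ‖projL hkn x‖ < R + 1 →
      ∀ᶠ y in 𝓝 x, cut k R (projL hkn y) = 1 := by
    intro R x hx
    have : ∀ᶠ y in 𝓝 x, ‖projL hkn y‖ < R + 1 :=
      ((projL hkn).continuous.norm.continuousAt).eventually (gt_mem_nhds hx)
    filter_upwards [this] with y hy
    apply ContDiffBump.one_of_mem_closedBall
    rw [mem_closedBall_zero_iff]
    exact hy.le
  have hloc : ∀ (R : ℕ) (x : Fin n → ℝ), ‖projL hkn x‖ < R + 1 →
      f =ᶠ[𝓝 x] (fun x => ∑' γ, S R γ x) := by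
    intro R x hx
    filter_upwards [hcut R x hx] with y hy
    simp only [hfdef, hSdef, hAdef, hy, one_mul]
  have hR : ∀ x : Fin n → ℝ, ∃ R : ℕ, ‖projL hkn x‖ < R + 1 := by
    intro x
    obtain ⟨R, hR⟩ := exists_nat_gt ‖projL hkn x‖
    exact ⟨R, by linarith⟩
  have hf : ContDiff ℝ ∞ f := by
    rw [contDiff_iff_contDiffAt]
    intro x
    obtain ⟨R, h⟩ := hR x
    exact (hser R).1.contDiffAt.congr_of_eventuallyEq (hloc R x h)
  refine ⟨f, hf, fun δ hδ a => ?_⟩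
  obtain ⟨R, h⟩ := hR (incl n k a)
  rw [mpd_congr_nhds δ hf (hser R).1 (hloc R _ h), (hser R).2]
  have hterm : ∀ γ, mpd δ (S R γ) (incl n k a)
      = if γ = δ then (mfact δ : ℝ) * G δ a else 0 := by
    intro γ
    have hev : S R γ =ᶠ[𝓝 (incl n k a)] fun x => G γ (projL hkn x) * mono γ x := by
      have hb : ∀ᶠ y in 𝓝 (incl n k a), ‖c γ • projQ n k y‖ < 1 := by
        have hcont : Continuous fun y => ‖c γ • projQ n k y‖ :=
          (c γ • projQ n k).continuous.norm
        have hlt : ‖c γ • projQ n k (incl n k a)‖ < 1 := by simp [projQ_incl]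
        exact (hcont.continuousAt (x := incl n k a)).eventually (gt_mem_nhds hlt)
      filter_upwards [hcut R _ h, hb] with y hy hby
      by_cases hγ : ∀ i : Fin n, (i : ℕ) < k → γ i = 0
      · have h1 : bmp n (c γ • projQ n k y) = 1 := by
          apply ContDiffBump.one_of_mem_closedBall
          rw [mem_closedBall_zero_iff]
          exact hby.le
        have h0 : c γ ^ (∑ i, γ i) ≠ 0 := pow_ne_zero _ (by linarith [hc1 γ])
        simp only [hSdef, hAdef, hTdef, hPdef, hy, h1, mono_scale hγ]
        field_simp
      · simp [hSdef, hAdef, hG0 γ hγ]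
    rw [mpd_congr_nhds δ ((hA R γ).mul (hT γ)).1 (cmono_smooth hkn (hG γ) γ) hev]
    by_cases hγ : ∀ i : Fin n, (i : ℕ) < k → γ i = 0
    · rw [mpd_mono_incl hkn (hG γ) γ δ hδ hγ]
      split_ifs with e
      · rw [e]
      · rfl
    · rw [mpd_mono hkn (hG γ) γ δ hδ, if_neg (by rintro rfl; exact hγ hδ)]
      simp [hG0 γ hγ]
  rw [tsum_congr hterm, tsum_ite_eq]

lemma extend_all (hkn : k ≤ n) {F : (Fin n → ℕ) → (Fin k → ℝ) → ℝ}
    (h2 : ∀ (α : Fin n → ℕ) (i : Fin k), pd i (F α) =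
      fun a => ((α (Fin.castLE hkn i) + 1 : ℕ) : ℝ) * F (α + Pi.single (Fin.castLE hkn i) 1) a)
    (hF : ∀ α, ContDiff ℝ ∞ (F α))
    {f : (Fin n → ℝ) → ℝ} (hf : ContDiff ℝ ∞ f)
    (h : ∀ δ : Fin n → ℕ, (∀ i : Fin n, (i : ℕ) < k → δ i = 0) → ∀ a,
        mpd δ f (incl n k a) = (mfact δ : ℝ) * F δ a) (α : Fin n → ℕ) :
    ∀ a, mpd α f (incl n k a) = (mfact α : ℝ) * F α a := by
  induction hm : ∑ i : Fin k, α (Fin.castLE hkn i) generalizing α with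
  | zero =>
    refine h α fun i hi => ?_
    exact (Finset.sum_eq_zero_iff.1 hm) ⟨i, hi⟩ (Finset.mem_univ _)
  | succ m ih =>
    obtain ⟨i, -, hi⟩ : ∃ i ∈ Finset.univ, α (Fin.castLE hkn i) ≠ 0 :=
      Finset.exists_ne_zero_of_sum_ne_zero (by rw [hm]; omega)
    obtain ⟨β, rfl⟩ : ∃ β : Fin n → ℕ, α = β + Pi.single (Fin.castLE hkn i) 1 := by
      refine ⟨α - Pi.single (Fin.castLE hkn i) 1, ?_⟩
      funext j
      by_cases hj : j = Fin.castLE hkn i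
      · subst hj; simp; omega
      · simp [Pi.single_eq_of_ne hj]
    have hβ : ∑ i : Fin k, β (Fin.castLE hkn i) = m := by
      have h1 : ∑ l : Fin k, (Pi.single (Fin.castLE hkn i) 1 : Fin n → ℕ) (Fin.castLE hkn l) = 1 := by
        rw [Finset.sum_eq_single i]
        · simp
        · intro l _ hl
          apply Pi.single_eq_of_ne
          intro e
          exact hl (Fin.castLE_injective hkn e)
        · simp
      simp only [Pi.add_apply, Finset.sum_add_distrib, h1] at hm
      omega
    intro a
    have ih' := ih β hβ
    rw [mpd_add_single _ _ hf, ← pd_comp_incl hkn i (mpd_smooth β hf), funext ih',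
      mfact_add_single]
    have h3 : pd i (fun a => (mfact β : ℝ) * F β a) a = (mfact β : ℝ) * pd i (F β) a := by
      unfold pd
      rw [fderiv_const_mul (((hF β).differentiable (by simp)) a)]
      simp
    rw [h3, h2]
    push_cast
    ring

end main


/-- **Borel's lemma with parameters.** A field of formal power series
`a ↦ Σ_α F_α(a) x^α` on `ℝ^k × {0} ⊆ ℝ^n` is the field of Taylor expansions of a single
`C^∞` function on `ℝ^n` if and only if each coefficient `F_α` is continuously
differentiable and `∂F_α/∂ξ_i = (α_i + 1) F_{α+e_i}` for all `α` and `i = 1,…,k`. -/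
theorem borel_lemma_with_parameters
    {n k : ℕ} (hk1 : 1 ≤ k) (hkn : k ≤ n)
    (F : (Fin n → ℕ) → (Fin k → ℝ) → ℝ) :
    (∃ f : (Fin n → ℝ) → ℝ, ContDiff ℝ (⊤ : ℕ∞) f ∧
        ∀ (a : Fin k → ℝ) (α : Fin n → ℕ),
          F α a = mpd α f (fun i : Fin n => if h : (i : ℕ) < k then a ⟨i, h⟩ else 0)
            / (mfact α : ℕ)) ↔
    ((∀ α : Fin n → ℕ, ContDiff ℝ 1 (F α)) ∧
      ∀ (α : Fin n → ℕ) (i : Fin k),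
        pd i (F α) =
          fun a => ((α (Fin.castLE hkn i) + 1 : ℕ) : ℝ) *
            F (α + Pi.single (Fin.castLE hkn i) 1) a) := by
  have hmf : ∀ α : Fin n → ℕ, (mfact α : ℝ) ≠ 0 := by
    intro α
    unfold mfact
    exact_mod_cast Finset.prod_ne_zero_iff.2 fun i _ => Nat.factorial_ne_zero _
  simp only [← incl_apply]
  constructor
  · rintro ⟨f, hf, hF⟩
    have hF' : ∀ α, F α = fun a => (mfact α : ℝ)⁻¹ * mpd α f (incl n k a) := by
      intro α
      funext a
      rw [hF, div_eq_inv_mul]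
    have hs : ∀ α, ContDiff ℝ ∞ (fun a => mpd α f (incl n k a)) := fun α =>
      (mpd_smooth α hf).comp (incl n k).contDiff
    refine ⟨fun α => ?_, fun α i => ?_⟩
    · rw [hF']
      exact (contDiff_const.mul (hs α)).of_le (by exact_mod_cast le_top)
    · funext a
      have h3 : pd i (F α) a = (mfact α : ℝ)⁻¹ * pd i (fun a => mpd α f (incl n k a)) a := by
        rw [hF' α]
        unfold pd
        rw [fderiv_const_mul (((hs α).differentiable (by simp)) a)]
        simp
      rw [h3, pd_comp_incl hkn i (mpd_smooth α hf), ← mpd_add_single _ _ hf, hF', mfact_add_single]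
      have h4 := hmf α
      have h5 : ((α (Fin.castLE hkn i) + 1 : ℕ) : ℝ) ≠ 0 := Nat.cast_ne_zero.2 (by omega)
      rw [Nat.cast_mul]
      field_simp
  · rintro ⟨h1, h2⟩
    classical
    have hF := family_smooth hkn h1 h2
    obtain ⟨f, hf, hfd⟩ := exists_transverse hkn
      (fun γ => if ∀ i : Fin n, (i : ℕ) < k → γ i = 0 then F γ else 0)
      (fun γ => by
        split_ifs
        · exact hF γ
        · exact contDiff_const)
      (fun γ hγ => if_neg hγ)
    refine ⟨f, hf, fun a α => ?_⟩
    rw [extend_all hkn h2 hF hf (fun δ hδ a => by rw [hfd δ hδ a, if_pos hδ]) α a]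
    field_simp [hmf α]

end QDC
end
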